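/- Let k ≥ 1 be a fixed integer. Then almost surely κ₃(G(n, p(n))) ≥ k, where p(n) = (log n + (k+1)·log log n − log log log n)/n. -/

import Mathlib

open Filter Asymptotics
open scoped Classical

noncomputable section

/-- The number of edges of a simple graph on a finite vertex type. -/
def edgeCount {V : Type*} [Fintype V] (G : SimpleGraph V) : ℕ :=
  G.edgeFinset.card

/-- Probability in the Erdős–Rényi model `G(n,p)` of a set `A` of graphs on `Fin n`:
each of the `n.choose 2` possible edges is present independently with probability `p`. -/
def gnpProb (n : ℕ) (p : ℝ) (A : Set (SimpleGraph (Fin n))) : ℝ :=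
  ∑ G ∈ Finset.univ.filter (fun G => G ∈ A),
    p ^ edgeCount G * (1 - p) ^ (n.choose 2 - edgeCount G)

/-- Probability in the uniform model `G(n,M)` of a set `A` of graphs on `Fin n`:
all graphs with exactly `M` edges are equally likely. -/
def gnmProb (n M : ℕ) (A : Set (SimpleGraph (Fin n))) : ℝ :=
  ((Finset.univ.filter (fun G : SimpleGraph (Fin n) => edgeCount G = M ∧ G ∈ A)).card : ℝ) /
    ((Finset.univ.filter (fun G : SimpleGraph (Fin n) => edgeCount G = M)).card : ℝ)

/-- `κ(S)`: the largest number of internally disjoint trees connecting `S`, i.e. trees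
`T₁, …, T_k` of `G` with `S ⊆ V(Tᵢ)`, `V(Tᵢ) ∩ V(Tⱼ) = S` and `E(Tᵢ) ∩ E(Tⱼ) = ∅`
for `i ≠ j`. -/
def kappaSet {V : Type*} (G : SimpleGraph V) (S : Set V) : ℕ :=
  sSup {k | ∃ T : Fin k → G.Subgraph,
    (∀ i, S ⊆ (T i).verts ∧ ((T i).coe).IsTree) ∧
    (∀ i j, i ≠ j → (T i).verts ∩ (T j).verts = S ∧
      (T i).edgeSet ∩ (T j).edgeSet = ∅)}

/-- `λ(S)`: the largest number of pairwise edge-disjoint trees of `G` each containing `S`. -/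
def lambdaSet {V : Type*} (G : SimpleGraph V) (S : Set V) : ℕ :=
  sSup {k | ∃ T : Fin k → G.Subgraph,
    (∀ i, S ⊆ (T i).verts ∧ ((T i).coe).IsTree) ∧
    (∀ i j, i ≠ j → (T i).edgeSet ∩ (T j).edgeSet = ∅)}

/-- The generalized `r`-connectivity `κ_r(G)`: the minimum of `κ(S)` over `r`-subsets `S`,
and `0` if `G` is disconnected. -/
def genKappa {V : Type*} [Fintype V] (r : ℕ) (G : SimpleGraph V) : ℕ :=
  if G.Connected then
    sInf {k | ∃ S : Finset V, S.card = r ∧ kappaSet G ↑S = k}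
  else 0

/-- The generalized `r`-edge-connectivity `λ_r(G)`: the minimum of `λ(S)` over
`r`-subsets `S`, and `0` if `G` is disconnected. -/
def genLambda {V : Type*} [Fintype V] (r : ℕ) (G : SimpleGraph V) : ℕ :=
  if G.Connected then
    sInf {k | ∃ S : Finset V, S.card = r ∧ lambdaSet G ↑S = k}
  else 0

/-- The vertex connectivity `κ(G)`: the largest `k` such that `G` is `k`-connected,
i.e. `k < |V|` and the removal of fewer than `k` vertices leaves a connected graph. -/
def vertexConnectivity {V : Type*} [Fintype V] (G : SimpleGraph V) : ℕ :=
  sSup {k | k < Fintype.card V ∧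
    ∀ S : Finset V, S.card < k → (G.induce ((↑S : Set V)ᶜ)).Connected}

/-- The edge connectivity `λ(G)`: the largest `k` such that removing fewer than `k`
edges always leaves a connected graph. -/
def edgeConnectivity {V : Type*} [Fintype V] (G : SimpleGraph V) : ℕ :=
  sSup {k | ∀ F : Finset (Sym2 V), F.card < k → (G.deleteEdges ↑F).Connected}

/-- The minimum degree `δ(G)`. -/
def minDeg {V : Type*} [Fintype V] (G : SimpleGraph V) : ℕ :=
  G.minDegree

/-- The number of children of `v` in the graph `H` viewed as rooted at `r`:
neighbours of `v` lying one step further from the root. -/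
def childCount {W : Type*} (H : SimpleGraph W) (r v : W) : ℕ :=
  {w | H.Adj v w ∧ H.dist r w = H.dist r v + 1}.ncard

/-- The depth of the graph `H` viewed as rooted at `r`: the largest distance from `r`. -/
def rootedDepth {W : Type*} (H : SimpleGraph W) (r : W) : ℕ :=
  sSup (Set.range (H.dist r))

/-- `T` is a subtree of `G` rooted at `r`, of depth `d`, in which every non-leaf
vertex has exactly `t` children (a `t`-ary tree of depth `d`). -/
def IsAryTreeOfDepth {V : Type*} {G : SimpleGraph V} (T : G.Subgraph) (r : V)
    (t d : ℕ) : Prop :=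
  ∃ hr : r ∈ T.verts,
    T.coe.IsTree ∧ rootedDepth T.coe ⟨r, hr⟩ = d ∧
      ∀ v : T.verts, childCount T.coe ⟨r, hr⟩ v = 0 ∨ childCount T.coe ⟨r, hr⟩ v = t

end

/-- Every connected subgraph has a spanning tree, as a subgraph of the ambient graph. -/
theorem exists_isTree_subgraph {V : Type*} {G : SimpleGraph V} (H : G.Subgraph)
    (hH : H.coe.Connected) :
    ∃ T : G.Subgraph, T.verts = H.verts ∧ T.edgeSet ⊆ H.edgeSet ∧ T.coe.IsTree := by
  obtain ⟨F, hF, hT⟩ := hH.exists_isTree_le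
  let T : G.Subgraph :=
    { verts := H.verts
      Adj := fun x y => ∃ (hx : x ∈ H.verts) (hy : y ∈ H.verts), F.Adj ⟨x, hx⟩ ⟨y, hy⟩
      adj_sub := by
        rintro x y ⟨hx, hy, h⟩
        exact H.adj_sub (hF h)
      edge_vert := by
        rintro x y ⟨hx, hy, h⟩
        exact hx
      symm := ⟨by
        rintro x y ⟨hx, hy, h⟩
        exact ⟨hy, hx, h.symm⟩⟩ }
  refine ⟨T, rfl, ?_, ?_⟩
  · intro e
    induction e with
    | _ x y =>
      rintro ⟨hx, hy, h⟩
      exact hF h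
  · have : T.coe = F := by
      ext x y
      constructor
      · rintro ⟨hx, hy, h⟩
        exact h
      · intro h
        exact ⟨x.2, y.2, h⟩
    rw [this]
    exact hT

/-- A subgraph whose underlying graph is connected and which has two distinct vertices has an
edge. -/
theorem edgeSet_nonempty_of_connected {V : Type*} {G : SimpleGraph V} (H : G.Subgraph)
    (hH : H.coe.Connected) {a b : V} (hab : a ≠ b) (ha : a ∈ H.verts) (hb : b ∈ H.verts) :
    H.edgeSet.Nonempty := by
  have : Nontrivial H.verts := ⟨⟨a, ha⟩, ⟨b, hb⟩, fun h => hab (congrArg Subtype.val h)⟩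
  obtain ⟨c, hc⟩ := hH.preconnected.exists_adj_of_nontrivial ⟨a, ha⟩
  exact ⟨s(a, c), hc⟩

/-- Internally disjoint connected subgraphs connecting `S` bound `κ(S)` from below. -/
theorem le_kappaSet {V : Type*} [Finite V] {G : SimpleGraph V} {S : Set V} {a b : V}
    (hab : a ≠ b) (ha : a ∈ S) (hb : b ∈ S) {k : ℕ} (H : Fin k → G.Subgraph)
    (hS : ∀ i, S ⊆ (H i).verts) (hc : ∀ i, (H i).coe.Connected)
    (hv : ∀ i j, i ≠ j → (H i).verts ∩ (H j).verts = S)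
    (he : ∀ i j, i ≠ j → (H i).edgeSet ∩ (H j).edgeSet = ∅) :
    k ≤ kappaSet G S := by
  unfold kappaSet
  apply le_csSup
  · refine ⟨Nat.card (Sym2 V), ?_⟩
    rintro m ⟨T, hT, hd⟩
    have hne : ∀ i, (T i).edgeSet.Nonempty := fun i =>
      edgeSet_nonempty_of_connected (T i) (hT i).2.connected hab ((hT i).1 ha) ((hT i).1 hb)
    choose e hemem using hne
    have hinj : Function.Injective e := by
      intro i j hij
      by_contra hne
      have : e i ∈ (T i).edgeSet ∩ (T j).edgeSet := ⟨hemem i, hij ▸ hemem j⟩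
      rw [(hd i j hne).2] at this
      exact this
    simpa using Nat.card_le_card_of_injective e hinj
  · choose T hTv hTe hT using fun i => exists_isTree_subgraph (H i) (hc i)
    refine ⟨T, fun i => ⟨by rw [hTv]; exact hS i, hT i⟩, fun i j hij => ⟨?_, ?_⟩⟩
    · rw [hTv, hTv, hv i j hij]
    · exact Set.subset_eq_empty (Set.inter_subset_inter (hTe i) (hTe j)) (he i j hij)

/-- A lower bound on `κ₃` from families of internally disjoint connected subgraphs. -/
theorem le_genKappa_three {n : ℕ} (hn : 3 ≤ n) {G : SimpleGraph (Fin n)} {k : ℕ} (hk : 1 ≤ k)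
    (h : ∀ S : Finset (Fin n), S.card = 3 → ∃ H : Fin k → G.Subgraph,
      (∀ i, (S : Set (Fin n)) ⊆ (H i).verts) ∧ (∀ i, (H i).coe.Connected) ∧
      (∀ i j, i ≠ j → (H i).verts ∩ (H j).verts = S) ∧
      ∀ i j, i ≠ j → (H i).edgeSet ∩ (H j).edgeSet = ∅) :
    k ≤ genKappa 3 G := by
  have hconn : G.Connected := by
    have : Nonempty (Fin n) := ⟨⟨0, by omega⟩⟩
    refine ⟨fun x y => ?_⟩
    obtain ⟨S, hxyS, hS⟩ : ∃ S : Finset (Fin n), {x, y} ⊆ S ∧ S.card = 3 :=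
      Finset.exists_superset_card_eq (le_trans Finset.card_le_two (by norm_num)) (by simpa using hn)
    obtain ⟨H, hSH, hc, -⟩ := h S hS
    have hx : x ∈ (H ⟨0, hk⟩).verts := hSH _ (by simpa using hxyS (by simp))
    have hy : y ∈ (H ⟨0, hk⟩).verts := hSH _ (by simpa using hxyS (by simp))
    exact ((hc ⟨0, hk⟩).preconnected ⟨x, hx⟩ ⟨y, hy⟩).map (H ⟨0, hk⟩).hom
  rw [genKappa, if_pos hconn]
  apply le_csInf
  · obtain ⟨S, -, hS⟩ : ∃ S : Finset (Fin n), ∅ ⊆ S ∧ S.card = 3 :=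
      Finset.exists_superset_card_eq (by simp) (by simpa using hn)
    exact ⟨_, S, hS, rfl⟩
  · rintro m ⟨S, hS, rfl⟩
    obtain ⟨H, hSH, hc, hv, he⟩ := h S hS
    obtain ⟨a, ha, b, hb, hab⟩ := Finset.one_lt_card.1 (by omega : 1 < S.card)
    exact le_kappaSet hab ha hb H hSH hc hv he

/-- The neighbours of `v` in `G`, as a finset. -/
noncomputable def nbrs {n : ℕ} (G : SimpleGraph (Fin n)) (v : Fin n) : Finset (Fin n) :=
  Finset.univ.filter (G.Adj v)

theorem mem_nbrs {n : ℕ} {G : SimpleGraph (Fin n)} {v w : Fin n} : w ∈ nbrs G v ↔ G.Adj v w := by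
  simp [nbrs]

/-- No small nonempty vertex set induces a subgraph of minimum degree at least `d`. -/
def SmallSetsSparse {n : ℕ} (G : SimpleGraph (Fin n)) (d m : ℕ) : Prop :=
  ∀ X : Finset (Fin n), X.Nonempty → (∀ x ∈ X, d ≤ (nbrs G x ∩ X).card) → m < X.card

/-- Any two disjoint large vertex sets are joined by an edge. -/
def LargeSetsJoined {n : ℕ} (G : SimpleGraph (Fin n)) (m : ℕ) : Prop :=
  ∀ X Y : Finset (Fin n), Disjoint X Y → m < X.card → m < Y.card → ∃ x ∈ X, ∃ y ∈ Y, G.Adj x y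

/-- A vertex set inducing a subgraph of large minimum degree induces a connected subgraph. -/
theorem induce_preconnected {n : ℕ} {G : SimpleGraph (Fin n)} {d m : ℕ}
    (hs : SmallSetsSparse G d m) (hl : LargeSetsJoined G m) (W : Finset (Fin n))
    (hW : ∀ x ∈ W, d ≤ (nbrs G x ∩ W).card) :
    (G.induce (W : Set (Fin n))).Preconnected := by
  intro x y
  by_contra hxy
  let R : ∀ _ : (W : Set (Fin n)), Finset (Fin n) := fun z =>
    W.filter fun v => ∃ hv : v ∈ (W : Set (Fin n)),
      (G.induce (W : Set (Fin n))).Reachable z ⟨v, hv⟩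
  have hR : ∀ z, m < (R z).card := by
    intro z
    apply hs
    · exact ⟨z, by simp only [R, Finset.mem_filter]; exact ⟨z.2, z.2, SimpleGraph.Reachable.rfl⟩⟩
    · intro v hv
      obtain ⟨hvW, hv', hzv⟩ := Finset.mem_filter.1 hv
      refine (hW v hvW).trans (Finset.card_le_card ?_)
      intro w hw
      obtain ⟨hvw, hwW⟩ := Finset.mem_inter.1 hw
      refine Finset.mem_inter.2 ⟨hvw, Finset.mem_filter.2 ⟨hwW, hwW, hzv.trans ?_⟩⟩
      exact SimpleGraph.Adj.reachable (mem_nbrs.1 hvw)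
  have hdisj : Disjoint (R x) (R y) := by
    rw [Finset.disjoint_left]
    intro v hv hv'
    obtain ⟨-, _, h1⟩ := Finset.mem_filter.1 hv
    obtain ⟨-, _, h2⟩ := Finset.mem_filter.1 hv'
    exact hxy (h1.trans h2.symm)
  obtain ⟨a, ha, b, hb, hab⟩ := hl _ _ hdisj (hR x) (hR y)
  obtain ⟨-, _, h1⟩ := Finset.mem_filter.1 ha
  obtain ⟨-, _, h2⟩ := Finset.mem_filter.1 hb
  exact hxy ((h1.trans (SimpleGraph.Adj.reachable (G := G.induce (W : Set (Fin n)))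
    (u := ⟨a, _⟩) (v := ⟨b, _⟩) hab)).trans h2.symm)

/-- The subgraph on `S ∪ C` of all edges that do not lie inside `S`. -/
def attachSubgraph {n : ℕ} (G : SimpleGraph (Fin n)) (S C : Set (Fin n)) : G.Subgraph where
  verts := S ∪ C
  Adj x y := G.Adj x y ∧ x ∈ S ∪ C ∧ y ∈ S ∪ C ∧ (x ∈ C ∨ y ∈ C)
  adj_sub h := h.1
  edge_vert h := h.2.1
  symm := ⟨fun _ _ h => ⟨h.1.symm, h.2.2.1, h.2.1, h.2.2.2.symm⟩⟩

theorem attachSubgraph_edgeSet_inter {n : ℕ} (G : SimpleGraph (Fin n)) {S C D : Set (Fin n)}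
    (hSD : Disjoint S D) (hCD : Disjoint C D) :
    (attachSubgraph G S C).edgeSet ∩ (attachSubgraph G S D).edgeSet = ∅ := by
  rw [Set.disjoint_left] at hSD hCD
  ext e
  induction e with
  | _ x y =>
    simp only [Set.mem_inter_iff, SimpleGraph.Subgraph.mem_edgeSet, attachSubgraph,
      Set.mem_union, Set.mem_empty_iff_false, iff_false]
    rintro ⟨⟨-, h1, h2, -⟩, -, h3, h4, h5 | h5⟩
    · exact h1.elim (fun h => hSD h h5) fun h => hCD h h5
    · exact h2.elim (fun h => hSD h h5) fun h => hCD h h5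

theorem attachSubgraph_verts_inter {n : ℕ} (G : SimpleGraph (Fin n)) {S C D : Set (Fin n)}
    (hCD : Disjoint C D) :
    (attachSubgraph G S C).verts ∩ (attachSubgraph G S D).verts = S := by
  change (S ∪ C) ∩ (S ∪ D) = S
  rw [← Set.union_inter_distrib_left, hCD.inter_eq, Set.union_empty]

/-- If `W` induces a connected subgraph and every vertex of `S ∪ C` is joined to `W` by a path
through `C`, then the attached subgraph is connected. -/
theorem attachSubgraph_connected {n : ℕ} {G : SimpleGraph (Fin n)} {S C W : Set (Fin n)}
    (hWC : W ⊆ C) (hWne : W.Nonempty) (hW : (G.induce W).Preconnected)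
    (hC : ∀ c ∈ C, c ∈ W ∨ (∃ w ∈ W, G.Adj c w) ∨ ∃ b ∈ C, G.Adj c b ∧ ∃ w ∈ W, G.Adj b w)
    (hS : ∀ s ∈ S, ∃ c ∈ C, G.Adj s c) :
    (attachSubgraph G S C).coe.Connected := by
  obtain ⟨w₀, hw₀⟩ := hWne
  set H := attachSubgraph G S C with hH
  have hCv : ∀ {c}, c ∈ C → c ∈ H.verts := fun h => Or.inr h
  have step : ∀ {a c} (ha : a ∈ H.verts) (hc : c ∈ C), G.Adj a c →
      H.coe.Reachable ⟨a, ha⟩ ⟨c, hCv hc⟩ := by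
    intro a c ha hc h
    apply SimpleGraph.Adj.reachable
    exact ⟨h, ha, hCv hc, Or.inr hc⟩
  have base : ∀ {w} (hw : w ∈ W),
      H.coe.Reachable ⟨w, hCv (hWC hw)⟩ ⟨w₀, hCv (hWC hw₀)⟩ := by
    intro w hw
    let f : G.induce W →g H.coe :=
      { toFun := fun x => ⟨x.1, hCv (hWC x.2)⟩
        map_rel' := fun {x y} h => ⟨h, hCv (hWC x.2), hCv (hWC y.2), Or.inl (hWC x.2)⟩ }
    exact (hW ⟨w, hw⟩ ⟨w₀, hw₀⟩).map f
  have hCr : ∀ {c} (hc : c ∈ C), H.coe.Reachable ⟨c, hCv hc⟩ ⟨w₀, hCv (hWC hw₀)⟩ := by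
    intro c hc
    rcases hC c hc with h | ⟨w, hw, h⟩ | ⟨b, hb, hcb, w, hw, h⟩
    · exact base h
    · exact (step _ (hWC hw) h).trans (base hw)
    · exact ((step _ hb hcb).trans (step _ (hWC hw) h)).trans (base hw)
  have hall : ∀ v : H.verts, H.coe.Reachable v ⟨w₀, hCv (hWC hw₀)⟩ := by
    rintro ⟨v, hv | hv⟩
    · obtain ⟨c, hc, h⟩ := hS v hv
      exact (step _ hc h).trans (hCr hc)
    · exact hCr hv
  have : Nonempty H.verts := ⟨⟨w₀, hCv (hWC hw₀)⟩⟩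
  exact ⟨fun x y => (hall x).trans (hall y).symm⟩

/-- The `j`-th of `k` nearly equal parts of `Fin n`. -/
def residuePart (n k j : ℕ) : Finset (Fin n) :=
  Finset.univ.filter fun v => v.val % k = j

theorem mem_residuePart {n k j : ℕ} {v : Fin n} : v ∈ residuePart n k j ↔ v.val % k = j := by
  simp [residuePart]

/-- The vertices with fewer than `d` neighbours in the `j`-th part. -/
noncomputable def poorVerts {n : ℕ} (G : SimpleGraph (Fin n)) (k d j : ℕ) : Finset (Fin n) :=
  Finset.univ.filter fun v => (nbrs G v ∩ residuePart n k j).card < d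

/-- The pseudo-random properties of `G(n,p)` that force `κ₃ ≥ k`. -/
structure IsPseudorandom {n : ℕ} (G : SimpleGraph (Fin n)) (k d₀ d M m : ℕ) : Prop where
  le_degree : ∀ v, k + 1 ≤ (nbrs G v).card
  not_adj : ∀ u v, (nbrs G u).card < d → (nbrs G v).card < d → ¬ G.Adj u v
  not_common : ∀ u v w, u ≠ v → (nbrs G u).card < d → (nbrs G v).card < d →
    G.Adj w u → ¬ G.Adj w v
  few_poor : ∀ v, ∀ j < k, (nbrs G v ∩ poorVerts G k d j).card < M
  sparse : SmallSetsSparse G d₀ m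
  joined : LargeSetsJoined G m

/-- Hall's theorem when all sets are at least as large as the index type. -/
theorem exists_injective_of_card_le {ι α : Type*} [Fintype ι] [DecidableEq α]
    (F : ι → Finset α) (hF : ∀ i, Fintype.card ι ≤ (F i).card) :
    ∃ f : ι → α, Function.Injective f ∧ ∀ i, f i ∈ F i := by
  rw [← Finset.all_card_le_biUnion_card_iff_exists_injective]
  intro s
  rcases s.eq_empty_or_nonempty with rfl | ⟨i, hi⟩
  · simp
  · exact (Finset.card_le_univ s).trans ((hF i).trans
      (Finset.card_le_card (Finset.subset_biUnion_of_mem F hi)))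

theorem card_biUnion_poorVerts {n : ℕ} {G : SimpleGraph (Fin n)} {k d₀ d M m : ℕ}
    (h : IsPseudorandom G k d₀ d M m) (v : Fin n) :
    (nbrs G v ∩ (Finset.range k).biUnion (poorVerts G k d)).card ≤ k * M := by
  rw [Finset.inter_biUnion]
  refine (Finset.card_biUnion_le).trans ?_
  refine (Finset.sum_le_card_nsmul _ _ M fun j hj => ?_).trans (by simp)
  exact (h.few_poor v j (Finset.mem_range.1 hj)).le

/-- Distinct large-degree neighbours outside `S` can be chosen for the vertices of `S`. -/
theorem exists_large_representatives {n : ℕ} {G : SimpleGraph (Fin n)} {k k' d₀ d M m : ℕ}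
    (h : IsPseudorandom G k d₀ d M m) (hk : 1 ≤ k) (hk' : k' ≤ k)
    (hd : d₀ + k * M + 6 * k + 4 ≤ d)
    {S : Finset (Fin n)} (hS : S.card ≤ 3) (hN : ∀ x ∈ S, k' ≤ (nbrs G x \ S).card) :
    ∃ a : S × Fin k' → Fin n, Function.Injective a ∧
      ∀ q, G.Adj q.1 (a q) ∧ a q ∉ S ∧ d ≤ (nbrs G (a q)).card := by
  obtain ⟨F, hF⟩ : ∃ F : Fin n → Finset (Fin n), ∀ x,
      F x = (nbrs G x \ S).filter fun y => d ≤ (nbrs G y).card := ⟨_, fun _ => rfl⟩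
  have hFsmall : ∀ x, (nbrs G x).card < d → F x = nbrs G x \ S := by
    intro x hx
    rw [hF]
    refine Finset.filter_true_of_mem fun y hy => ?_
    by_contra hlt
    exact h.not_adj x y hx (not_le.1 hlt) (mem_nbrs.1 (Finset.mem_sdiff.1 hy).1)
  have hFlarge : ∀ x, d ≤ (nbrs G x).card → 3 * k ≤ (F x).card := by
    intro x hx
    have hsub : nbrs G x ⊆ (F x ∪ S) ∪ (nbrs G x ∩ poorVerts G k d 0) := by
      intro y hy
      by_cases hyS : y ∈ S
      · simp [hyS]
      by_cases hyd : d ≤ (nbrs G y).card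
      · simp [hF, hy, hyS, hyd]
      · refine Finset.mem_union_right _ (Finset.mem_inter.2 ⟨hy, ?_⟩)
        simp only [poorVerts, Finset.mem_filter, Finset.mem_univ, true_and]
        exact (Finset.card_le_card Finset.inter_subset_left).trans_lt (not_le.1 hyd)
    have h1 := Finset.card_le_card hsub
    have h2 := Finset.card_union_le (F x ∪ S) (nbrs G x ∩ poorVerts G k d 0)
    have h3 := Finset.card_union_le (F x) S
    have h4 := h.few_poor x 0 hk
    have h5 : M ≤ k * M := Nat.le_mul_of_pos_left _ hk
    omega
  have hall : ∀ s : Finset (S × Fin k'), s.card ≤ (s.biUnion fun q => F q.1).card := by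
    intro s
    by_cases hs : ∃ q ∈ s, d ≤ (nbrs G q.1).card
    · obtain ⟨q, hq, hqd⟩ := hs
      have h1 : s.card ≤ 3 * k := by
        refine (Finset.card_le_univ s).trans ?_
        simp only [Fintype.card_prod, Fintype.card_coe, Fintype.card_fin]
        exact Nat.mul_le_mul hS hk'
      have h2 : F q.1 ⊆ s.biUnion fun q => F q.1 := fun y hy =>
        Finset.mem_biUnion.2 ⟨q, hq, hy⟩
      exact h1.trans ((hFlarge q.1 hqd).trans (Finset.card_le_card h2))
    · push Not at hs
      have h1 : (s.biUnion fun q => F q.1) = (s.image Prod.fst).biUnion fun x => F x := by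
        rw [Finset.image_biUnion]
      rw [h1, Finset.card_biUnion]
      · have h2 : s ⊆ s.image Prod.fst ×ˢ (Finset.univ : Finset (Fin k')) := by
          intro q hq
          simp only [Finset.mem_product, Finset.mem_univ, and_true]
          exact Finset.mem_image_of_mem _ hq
        refine (Finset.card_le_card h2).trans ?_
        rw [Finset.card_product, Finset.card_univ, Fintype.card_fin, ← smul_eq_mul]
        refine Finset.card_nsmul_le_sum _ _ _ fun x hx => ?_
        obtain ⟨q, hq, rfl⟩ := Finset.mem_image.1 hx
        rw [hFsmall _ (hs q hq)]
        exact hN _ q.1.2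
      · intro x hx y hy hxy
        obtain ⟨q, hq, rfl⟩ := Finset.mem_image.1 hx
        obtain ⟨r, hr, rfl⟩ := Finset.mem_image.1 hy
        rw [Function.onFun, hFsmall _ (hs q hq), hFsmall _ (hs r hr), Finset.disjoint_left]
        intro z hz hz'
        exact h.not_common q.1 r.1 z (fun e => hxy (Subtype.ext e)) (hs q hq) (hs r hr)
          (mem_nbrs.1 (Finset.mem_sdiff.1 hz).1).symm (mem_nbrs.1 (Finset.mem_sdiff.1 hz').1).symm
  obtain ⟨a, ha, haF⟩ := (Finset.all_card_le_biUnion_card_iff_exists_injective _).1 hall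
  refine ⟨a, ha, fun q => ?_⟩
  have := haF q
  simp only [hF, Finset.mem_filter, Finset.mem_sdiff, mem_nbrs] at this
  exact ⟨this.1.1, this.1.2, this.2⟩

/-- Disjoint connected attachments to a small vertex set `S` all of whose vertices have enough
neighbours outside `S`. -/
theorem exists_disjoint_attachments {n : ℕ} {G : SimpleGraph (Fin n)} {k k' d₀ d M m : ℕ}
    (h : IsPseudorandom G k d₀ d M m) (hk : 1 ≤ k) (hk' : k' ≤ k) (hd₀ : 1 ≤ d₀)
    (hd : d₀ + k * M + 9 * k + 4 ≤ d)
    {S : Finset (Fin n)} (hSne : S.Nonempty) (hS : S.card ≤ 3)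
    (hN : ∀ x ∈ S, k' ≤ (nbrs G x \ S).card) :
    ∃ C : Fin k' → Set (Fin n), (∀ i, Disjoint (S : Set (Fin n)) (C i)) ∧
      (∀ i j, i ≠ j → Disjoint (C i) (C j)) ∧
      ∀ i, (attachSubgraph G (S : Set (Fin n)) (C i)).coe.Connected := by
  obtain ⟨a, ha, haS⟩ := exists_large_representatives h hk hk' (by omega) hS hN
  obtain ⟨B, hB⟩ : ∃ B, B = (Finset.range k).biUnion (poorVerts G k d) := ⟨_, rfl⟩
  have hBcard : ∀ v, (nbrs G v ∩ B).card ≤ k * M := fun v => hB ▸ card_biUnion_poorVerts h v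
  have hι : Fintype.card (S × Fin k') ≤ 3 * k := by
    simp only [Fintype.card_prod, Fintype.card_coe, Fintype.card_fin]
    exact Nat.mul_le_mul hS hk'
  obtain ⟨A, hA⟩ : ∃ A, A = Finset.univ.image a := ⟨_, rfl⟩
  have hAcard : A.card ≤ 3 * k := by
    rw [hA]
    exact Finset.card_image_le.trans hι
  obtain ⟨b, hb, hbF⟩ := exists_injective_of_card_le
    (fun q : S × Fin k' => nbrs G (a q) \ (B ∪ (S ∪ A))) (by
      intro q
      have h1 : nbrs G (a q) ⊆ (nbrs G (a q) \ (B ∪ (S ∪ A))) ∪ ((nbrs G (a q) ∩ B) ∪ (S ∪ A)) := by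
        intro y hy
        simp only [Finset.mem_union, Finset.mem_sdiff, Finset.mem_inter, hy, true_and]
        tauto
      have h2 := Finset.card_le_card h1
      have h3 := Finset.card_union_le (nbrs G (a q) \ (B ∪ (S ∪ A))) ((nbrs G (a q) ∩ B) ∪ (S ∪ A))
      have h4 := Finset.card_union_le (nbrs G (a q) ∩ B) (S ∪ A)
      have h5 := Finset.card_union_le S A
      have h6 := hBcard (a q)
      have h7 := (haS q).2.2
      omega)
  have hb' : ∀ q, G.Adj (a q) (b q) ∧ b q ∉ B ∧ b q ∉ S ∧ b q ∉ A := by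
    intro q
    have := hbF q
    simp only [Finset.mem_sdiff, Finset.mem_union, not_or, mem_nbrs] at this
    exact ⟨this.1, this.2.1, this.2.2.1, this.2.2.2⟩
  obtain ⟨D, hD⟩ : ∃ D, D = Finset.univ.image b := ⟨_, rfl⟩
  have hDcard : D.card ≤ 3 * k := by
    rw [hD]
    exact Finset.card_image_le.trans hι
  have haA : ∀ q, a q ∈ A := fun q => hA ▸ Finset.mem_image_of_mem a (Finset.mem_univ q)
  have hbD : ∀ q, b q ∈ D := fun q => hD ▸ Finset.mem_image_of_mem b (Finset.mem_univ q)
  obtain ⟨W, hW⟩ : ∃ W : Fin k' → Finset (Fin n),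
      ∀ i, W i = residuePart n k i \ (B ∪ (S ∪ (A ∪ D))) := ⟨_, fun _ => rfl⟩
  have hWmem : ∀ i v, v ∈ W i ↔ v.val % k = i ∧ v ∉ B ∧ v ∉ S ∧ v ∉ A ∧ v ∉ D := by
    intro i v
    simp only [hW, Finset.mem_sdiff, Finset.mem_union, not_or, mem_residuePart]
  have hdeg : ∀ (i : Fin k') v, v ∉ B → d₀ ≤ (nbrs G v ∩ W i).card := by
    intro i v hv
    have h1 : d ≤ (nbrs G v ∩ residuePart n k i).card := by
      by_contra hlt
      refine hv (hB ▸ Finset.mem_biUnion.2 ⟨i, Finset.mem_range.2 (i.2.trans_le hk'), ?_⟩)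
      simpa [poorVerts] using hlt
    have h2 : nbrs G v ∩ residuePart n k i ⊆
        (nbrs G v ∩ W i) ∪ ((nbrs G v ∩ B) ∪ (S ∪ (A ∪ D))) := by
      intro y hy
      obtain ⟨hy1, hy2⟩ := Finset.mem_inter.1 hy
      simp only [hW, Finset.mem_union, Finset.mem_sdiff, Finset.mem_inter, hy1, hy2, true_and]
      tauto
    have h3 := Finset.card_le_card h2
    have h4 := Finset.card_union_le (nbrs G v ∩ W i) ((nbrs G v ∩ B) ∪ (S ∪ (A ∪ D)))
    have h5 := Finset.card_union_le (nbrs G v ∩ B) (S ∪ (A ∪ D))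
    have h6 := Finset.card_union_le S (A ∪ D)
    have h7 := Finset.card_union_le A D
    have h8 := hBcard v
    omega
  have hnb : ∀ (i : Fin k') v, v ∉ B → ∃ w ∈ W i, G.Adj v w := by
    intro i v hv
    obtain ⟨w, hw⟩ := Finset.card_pos.1 (hd₀.trans (hdeg i v hv))
    exact ⟨w, (Finset.mem_inter.1 hw).2, mem_nbrs.1 (Finset.mem_inter.1 hw).1⟩
  refine ⟨fun i => {v | v ∈ W i ∨ ∃ x : S, v = a (x, i) ∨ v = b (x, i)}, ?_, ?_, ?_⟩
  · intro i
    rw [Set.disjoint_left]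
    rintro v hv (hv' | ⟨x, rfl | rfl⟩)
    · exact ((hWmem i v).1 hv').2.2.1 hv
    · exact (haS _).2.1 hv
    · exact (hb' _).2.2.1 hv
  · intro i j hij
    rw [Set.disjoint_left]
    rintro v (hv | ⟨x, rfl | rfl⟩) (hv' | ⟨y, hy | hy⟩)
    · exact hij (Fin.ext (((hWmem i v).1 hv).1.symm.trans ((hWmem j v).1 hv').1))
    · exact ((hWmem i v).1 hv).2.2.2.1 (hy ▸ haA _)
    · exact ((hWmem i v).1 hv).2.2.2.2 (hy ▸ hbD _)
    · exact ((hWmem j _).1 hv').2.2.2.1 (haA _)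
    · exact hij (congrArg Prod.snd (ha hy))
    · exact (hb' (y, j)).2.2.2 (hy ▸ haA _)
    · exact ((hWmem j _).1 hv').2.2.2.2 (hbD _)
    · exact (hb' (x, i)).2.2.2 (hy ▸ haA _)
    · exact hij (congrArg Prod.snd (hb hy))
  · intro i
    obtain ⟨x₀, hx₀⟩ := hSne
    obtain ⟨w₀, hw₀, -⟩ := hnb i (b (⟨x₀, hx₀⟩, i)) (hb' _).2.1
    refine attachSubgraph_connected (W := (W i : Set (Fin n))) (fun v hv => Or.inl hv) ⟨w₀, hw₀⟩
      (induce_preconnected h.sparse h.joined (W i) fun x hx =>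
        hdeg i x ((hWmem i x).1 hx).2.1) ?_ ?_
    · rintro v (hv | ⟨x, rfl | rfl⟩)
      · exact Or.inl hv
      · exact Or.inr (Or.inr ⟨b (x, i), Or.inr ⟨x, Or.inr rfl⟩, (hb' _).1, hnb i _ (hb' _).2.1⟩)
      · exact Or.inr (Or.inl (hnb i _ (hb' _).2.1))
    · intro s hs
      exact ⟨a (⟨s, hs⟩, i), Or.inr ⟨⟨s, hs⟩, Or.inl rfl⟩, (haS (⟨s, hs⟩, i)).1⟩

/-- The subgraph induced on `S` is connected if some vertex of `S` is adjacent to all others. -/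
theorem induce_connected_of_center {n : ℕ} {G : SimpleGraph (Fin n)} {S : Finset (Fin n)}
    {u : Fin n} (hu : u ∈ S) (h : ∀ v ∈ S, v ≠ u → G.Adj u v) :
    ((⊤ : G.Subgraph).induce (S : Set (Fin n))).coe.Connected := by
  have hall : ∀ v : ((⊤ : G.Subgraph).induce (S : Set (Fin n))).verts,
      ((⊤ : G.Subgraph).induce (S : Set (Fin n))).coe.Reachable ⟨u, hu⟩ v := by
    rintro ⟨v, hv⟩
    by_cases huv : v = u
    · subst huv
      exact SimpleGraph.Reachable.rfl
    · exact SimpleGraph.Adj.reachable ⟨hu, hv, h v hv huv⟩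
  have : Nonempty ((⊤ : G.Subgraph).induce (S : Set (Fin n))).verts := ⟨⟨u, hu⟩⟩
  exact ⟨fun x y => (hall x).symm.trans (hall y)⟩

/-- Pseudo-random graphs have large generalized `3`-connectivity. -/
theorem IsPseudorandom.le_genKappa {n : ℕ} {G : SimpleGraph (Fin n)} {k d₀ d M m : ℕ}
    (h : IsPseudorandom G k d₀ d M m) (hn : 3 ≤ n) (hk : 1 ≤ k) (hd₀ : 1 ≤ d₀)
    (hd : d₀ + k * M + 9 * k + 4 ≤ d) : k ≤ genKappa 3 G := by
  refine le_genKappa_three hn hk fun S hS => ?_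
  have hSne : S.Nonempty := Finset.card_pos.1 (by omega)
  by_cases hN : ∀ x ∈ S, k ≤ (nbrs G x \ S).card
  · obtain ⟨C, hSC, hC, hconn⟩ := exists_disjoint_attachments h hk le_rfl hd₀ hd hSne hS.le hN
    refine ⟨fun i => attachSubgraph G S (C i), fun i => Set.subset_union_left, hconn,
      fun i j hij => attachSubgraph_verts_inter G (hC i j hij),
      fun i j hij => attachSubgraph_edgeSet_inter G (hSC j) (hC i j hij)⟩
  · push Not at hN
    obtain ⟨u, hu, hlt⟩ := hN
    have hsplit : ∀ x, (nbrs G x ∩ S).card + (nbrs G x \ S).card = (nbrs G x).card := fun x => by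
      rw [add_comm]
      exact Finset.card_sdiff_add_card_inter _ _
    have hsub : ∀ x ∈ S, nbrs G x ∩ S ⊆ S.erase x := by
      intro x _ y hy
      obtain ⟨hy1, hy2⟩ := Finset.mem_inter.1 hy
      exact Finset.mem_erase.2 ⟨(mem_nbrs.1 hy1).ne', hy2⟩
    have herase : ∀ x ∈ S, (S.erase x).card = 2 := fun x hx => by
      rw [Finset.card_erase_of_mem hx, hS]
    have hinter : ∀ x ∈ S, (nbrs G x ∩ S).card ≤ 2 := fun x hx =>
      (Finset.card_le_card (hsub x hx)).trans (herase x hx).le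
    have hueq : nbrs G u ∩ S = S.erase u := by
      refine Finset.eq_of_subset_of_card_le (hsub u hu) ?_
      have h1 := hsplit u
      have h2 := h.le_degree u
      have h3 := herase u hu
      omega
    have huadj : ∀ v ∈ S, v ≠ u → G.Adj u v := by
      intro v hv hvu
      have : v ∈ nbrs G u ∩ S := hueq ▸ Finset.mem_erase.2 ⟨hvu, hv⟩
      exact mem_nbrs.1 (Finset.mem_inter.1 this).1
    obtain ⟨k', rfl⟩ : ∃ k', k = k' + 1 := ⟨k - 1, by omega⟩
    have hN' : ∀ x ∈ S, k' ≤ (nbrs G x \ S).card := by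
      intro x hx
      have h1 := hsplit x
      have h2 := h.le_degree x
      have h3 := hinter x hx
      omega
    obtain ⟨C, hSC, hC, hconn⟩ :=
      exists_disjoint_attachments h hk (Nat.le_succ k') hd₀ hd hSne hS.le hN'
    have hvspecial : ∀ i, (S : Set (Fin n)) ∩ (attachSubgraph G S (C i)).verts = S := fun i =>
      Set.inter_eq_left.2 Set.subset_union_left
    have hespecial : ∀ i, ((⊤ : G.Subgraph).induce (S : Set (Fin n))).edgeSet ∩
        (attachSubgraph G S (C i)).edgeSet = ∅ := by
      intro i
      have hdis := Set.disjoint_left.1 (hSC i)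
      ext e
      induction e with
      | _ x y =>
        simp only [Set.mem_inter_iff, SimpleGraph.Subgraph.mem_edgeSet, Set.mem_empty_iff_false,
          iff_false]
        rintro ⟨⟨hx, hy, -⟩, -, -, -, hc | hc⟩
        · exact hdis hx hc
        · exact hdis hy hc
    refine ⟨Fin.cons ((⊤ : G.Subgraph).induce (S : Set (Fin n)))
      fun i => attachSubgraph G S (C i), ?_, ?_, ?_, ?_⟩
    · refine Fin.cases ?_ fun i => ?_
      · exact subset_rfl
      · exact Set.subset_union_left
    · refine Fin.cases ?_ fun i => ?_
      · exact induce_connected_of_center hu huadj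
      · exact hconn i
    · refine Fin.cases (Fin.cases ?_ fun j => ?_) fun i => Fin.cases ?_ fun j => ?_
      · exact fun hne => absurd rfl hne
      · exact fun _ => hvspecial j
      · exact fun _ => (Set.inter_comm _ _).trans (hvspecial i)
      · exact fun hne => attachSubgraph_verts_inter G (hC i j fun e => hne (congrArg _ e))
    · refine Fin.cases (Fin.cases ?_ fun j => ?_) fun i => Fin.cases ?_ fun j => ?_
      · exact fun hne => absurd rfl hne
      · exact fun _ => hespecial j
      · exact fun _ => (Set.inter_comm _ _).trans (hespecial i)
      · exact fun hne =>
          attachSubgraph_edgeSet_inter G (hSC j) (hC i j fun e => hne (congrArg _ e))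

/-- The unordered pairs of distinct vertices. -/
def vertexPairs (n : ℕ) : Finset (Sym2 (Fin n)) :=
  Finset.univ.filter fun e => ¬ e.IsDiag

/-- The edges of `G`, as a finset. -/
noncomputable def edges {n : ℕ} (G : SimpleGraph (Fin n)) : Finset (Sym2 (Fin n)) :=
  Finset.univ.filter fun e => e ∈ G.edgeSet

theorem mem_edges {n : ℕ} {G : SimpleGraph (Fin n)} {e : Sym2 (Fin n)} :
    e ∈ edges G ↔ e ∈ G.edgeSet := by
  simp [edges]

theorem edges_subset {n : ℕ} (G : SimpleGraph (Fin n)) : edges G ⊆ vertexPairs n := by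
  intro e he
  simp only [vertexPairs, Finset.mem_filter, Finset.mem_univ, true_and]
  exact G.not_isDiag_of_mem_edgeSet (mem_edges.1 he)

theorem card_edges {n : ℕ} (G : SimpleGraph (Fin n)) : (edges G).card = edgeCount G := by
  unfold edgeCount
  congr 1
  ext e
  simp [mem_edges]

theorem card_vertexPairs (n : ℕ) : (vertexPairs n).card = n.choose 2 := by
  have h := SimpleGraph.card_edgeFinset_top_eq_card_choose_two (V := Fin n)
  rw [Fintype.card_fin] at h
  rw [← h]
  congr 1
  ext e
  simp [vertexPairs]

/-- Expanding a product over all vertex pairs as a sum over graphs. -/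
theorem sum_prod_edges {n : ℕ} (f g : Sym2 (Fin n) → ℝ) :
    ∑ G : SimpleGraph (Fin n), (∏ e ∈ edges G, f e) * ∏ e ∈ vertexPairs n \ edges G, g e =
      ∏ e ∈ vertexPairs n, (f e + g e) := by
  rw [Finset.prod_add]
  refine Finset.sum_bij' (fun G _ => edges G)
    (fun t _ => SimpleGraph.fromEdgeSet (t : Set (Sym2 (Fin n)))) ?_ ?_ ?_ ?_ ?_
  · intro G _
    exact Finset.mem_powerset.2 (edges_subset G)
  · intro t _
    exact Finset.mem_univ _
  · intro G _
    have : ((edges G : Finset (Sym2 (Fin n))) : Set (Sym2 (Fin n))) = G.edgeSet := by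
      ext e
      simp [mem_edges]
    simp only [this, SimpleGraph.fromEdgeSet_edgeSet]
  · intro t ht
    ext e
    have hd : e ∈ t → ¬ e.IsDiag := fun he => by
      simpa [vertexPairs] using Finset.mem_powerset.1 ht he
    simp only [mem_edges, SimpleGraph.edgeSet_fromEdgeSet, Set.mem_sdiff, Finset.mem_coe]
    exact ⟨fun h => h.1, fun h => ⟨h, by simpa using hd h⟩⟩
  · intro G _
    rfl

theorem gnpProb_weight_eq {n : ℕ} (p : ℝ) (x : Sym2 (Fin n) → ℝ) :
    ∑ G : SimpleGraph (Fin n), (p ^ edgeCount G * (1 - p) ^ (n.choose 2 - edgeCount G)) *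
      ∏ e ∈ edges G, x e = ∏ e ∈ vertexPairs n, (1 - p + p * x e) := by
  have h := sum_prod_edges (fun e => p * x e) (fun _ => 1 - p)
  rw [Finset.prod_congr rfl fun e _ => add_comm (1 - p) (p * x e), ← h]
  refine Finset.sum_congr rfl fun G _ => ?_
  rw [Finset.prod_mul_distrib, Finset.prod_const, Finset.prod_const,
    Finset.card_sdiff_of_subset (edges_subset G), card_edges, card_vertexPairs]
  ring

theorem gnpProb_univ (n : ℕ) (p : ℝ) : gnpProb n p Set.univ = 1 := by
  have h := gnpProb_weight_eq p (fun _ : Sym2 (Fin n) => (1 : ℝ))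
  simpa [gnpProb] using h

theorem gnpProb_eq_sum_ite {n : ℕ} (p : ℝ) (A : Set (SimpleGraph (Fin n))) :
    gnpProb n p A = ∑ G : SimpleGraph (Fin n),
      if G ∈ A then p ^ edgeCount G * (1 - p) ^ (n.choose 2 - edgeCount G) else 0 := by
  rw [gnpProb, Finset.sum_filter]

section Probability

variable {n : ℕ} {p : ℝ}

theorem gnp_weight_nonneg (hp₀ : 0 ≤ p) (hp₁ : p ≤ 1) (a b : ℕ) :
    0 ≤ p ^ a * (1 - p) ^ b :=
  mul_nonneg (pow_nonneg hp₀ _) (pow_nonneg (by linarith) _)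

theorem gnpProb_mono (hp₀ : 0 ≤ p) (hp₁ : p ≤ 1) {A B : Set (SimpleGraph (Fin n))}
    (h : A ⊆ B) : gnpProb n p A ≤ gnpProb n p B := by
  refine Finset.sum_le_sum_of_subset_of_nonneg (fun G hG => ?_)
    fun _ _ _ => gnp_weight_nonneg hp₀ hp₁ _ _
  simp only [Finset.mem_filter, Finset.mem_univ, true_and] at hG ⊢
  exact h hG

theorem gnpProb_union_le (hp₀ : 0 ≤ p) (hp₁ : p ≤ 1) (A B : Set (SimpleGraph (Fin n))) :
    gnpProb n p (A ∪ B) ≤ gnpProb n p A + gnpProb n p B := by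
  rw [gnpProb_eq_sum_ite, gnpProb_eq_sum_ite, gnpProb_eq_sum_ite, ← Finset.sum_add_distrib]
  refine Finset.sum_le_sum fun G _ => ?_
  have := gnp_weight_nonneg hp₀ hp₁ (edgeCount G) (n.choose 2 - edgeCount G)
  by_cases hA : G ∈ A <;> by_cases hB : G ∈ B <;> simp [hA, hB, this]

theorem gnpProb_biUnion_le (hp₀ : 0 ≤ p) (hp₁ : p ≤ 1) {ι : Type*} (s : Finset ι)
    (A : ι → Set (SimpleGraph (Fin n))) :
    gnpProb n p {G | ∃ i ∈ s, G ∈ A i} ≤ ∑ i ∈ s, gnpProb n p (A i) := by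
  simp only [gnpProb_eq_sum_ite]
  rw [Finset.sum_comm]
  refine Finset.sum_le_sum fun G _ => ?_
  have hw := gnp_weight_nonneg hp₀ hp₁ (edgeCount G) (n.choose 2 - edgeCount G)
  have hnn : ∀ i ∈ s, 0 ≤ if G ∈ A i then
      p ^ edgeCount G * (1 - p) ^ (n.choose 2 - edgeCount G) else 0 := fun i _ => by
    split_ifs
    exacts [hw, le_rfl]
  split_ifs with h
  · obtain ⟨i, hi, hGi⟩ := h
    refine le_trans ?_ (Finset.single_le_sum hnn hi)
    rw [if_pos hGi]
  · exact Finset.sum_nonneg hnn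

/-- Exponential-moment bound for `G(n,p)`. -/
theorem gnpProb_le_of_weight (hp₀ : 0 ≤ p) (hp₁ : p ≤ 1) (A : Set (SimpleGraph (Fin n)))
    (x : Sym2 (Fin n) → ℝ) (hx : ∀ e, 0 ≤ x e) {C : ℝ} (hC : 0 ≤ C)
    (h : ∀ G ∈ A, 1 ≤ C * ∏ e ∈ edges G, x e) :
    gnpProb n p A ≤ C * ∏ e ∈ vertexPairs n, (1 - p + p * x e) := by
  rw [← gnpProb_weight_eq, Finset.mul_sum, gnpProb_eq_sum_ite]
  refine Finset.sum_le_sum fun G _ => ?_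
  have hw := gnp_weight_nonneg hp₀ hp₁ (edgeCount G) (n.choose 2 - edgeCount G)
  have hprod : 0 ≤ ∏ e ∈ edges G, x e := Finset.prod_nonneg fun e _ => hx e
  split_ifs with hG
  · calc _ ≤ (p ^ edgeCount G * (1 - p) ^ (n.choose 2 - edgeCount G)) *
          (C * ∏ e ∈ edges G, x e) := le_mul_of_one_le_right hw (h G hG)
      _ = _ := by ring
  · positivity

/-- The pairs with one element in `Y` and the other in `U`. -/
def crossPairs (Y U : Finset (Fin n)) : Finset (Sym2 (Fin n)) :=
  (Y ×ˢ U).image fun q => s(q.1, q.2)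

theorem card_crossPairs {Y U : Finset (Fin n)} (h : Disjoint Y U) :
    (crossPairs Y U).card = Y.card * U.card := by
  rw [crossPairs, Finset.card_image_of_injOn, Finset.card_product]
  rintro ⟨a, b⟩ hab ⟨c, d⟩ hcd heq
  simp only [Finset.coe_product, Set.mem_prod, Finset.mem_coe] at hab hcd
  rcases Sym2.eq_iff.1 heq with ⟨h1, h2⟩ | ⟨h1, h2⟩
  · exact Prod.ext h1 h2
  · have had : a = d := h1
    exact absurd (had ▸ hcd.2) (Finset.disjoint_left.1 h hab.1)

theorem crossPairs_subset {Y U : Finset (Fin n)} (h : Disjoint Y U) :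
    crossPairs Y U ⊆ vertexPairs n := by
  intro e he
  obtain ⟨⟨a, b⟩, hab, rfl⟩ := Finset.mem_image.1 he
  obtain ⟨ha, hb⟩ := Finset.mem_product.1 hab
  simp only [vertexPairs, Finset.mem_filter, Finset.mem_univ, true_and, Sym2.mk_isDiag_iff]
  rintro rfl
  exact Finset.disjoint_left.1 h ha hb

theorem card_edges_inter_crossPairs_le (G : SimpleGraph (Fin n)) (Y U : Finset (Fin n)) {d : ℕ}
    (h : ∀ y ∈ Y, (nbrs G y ∩ U).card ≤ d) : (edges G ∩ crossPairs Y U).card ≤ Y.card * d := by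
  have hsub : edges G ∩ crossPairs Y U ⊆
      Y.biUnion fun y => (nbrs G y ∩ U).image fun u => s(y, u) := by
    intro e he
    obtain ⟨he1, he2⟩ := Finset.mem_inter.1 he
    obtain ⟨⟨a, b⟩, hab, rfl⟩ := Finset.mem_image.1 he2
    obtain ⟨ha, hb⟩ := Finset.mem_product.1 hab
    exact Finset.mem_biUnion.2 ⟨a, ha, Finset.mem_image_of_mem _
      (Finset.mem_inter.2 ⟨mem_nbrs.2 (mem_edges.1 he1), hb⟩)⟩
  refine (Finset.card_le_card hsub).trans (Finset.card_biUnion_le.trans ?_)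
  exact Finset.sum_le_card_nsmul _ _ d fun y hy => Finset.card_image_le.trans (h y hy)

/-- The probability that all pairs of `Q` are edges and that few edges join `Y` to `U`. -/
theorem gnpProb_cross_le (hp₀ : 0 < p) (hp₁ : p ≤ 1) {Y U : Finset (Fin n)} (hYU : Disjoint Y U)
    {Q : Finset (Sym2 (Fin n))} (hQ : Q ⊆ vertexPairs n) (hQR : Disjoint Q (crossPairs Y U))
    {z : ℝ} (hz₀ : 0 ≤ z) (hz₁ : z ≤ 1) {D : ℕ} (hzD : 0 < z ^ D)
    (A : Set (SimpleGraph (Fin n)))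
    (hA : ∀ G ∈ A, Q ⊆ edges G ∧ (edges G ∩ crossPairs Y U).card ≤ D) :
    gnpProb n p A ≤
      (2 * p) ^ Q.card * ((z ^ D)⁻¹ * Real.exp (-((1 - z) * p * (Y.card * U.card)))) := by
  have hprod : ∀ (f : Sym2 (Fin n) → ℝ) (a b : ℝ) (s : Finset (Sym2 (Fin n))),
      (∀ e ∈ Q, f e = a) → (∀ e ∈ crossPairs Y U, f e = b) →
      (∀ e, e ∉ Q → e ∉ crossPairs Y U → f e = 1) →
      ∏ e ∈ s, f e = a ^ (s ∩ Q).card * b ^ (s ∩ crossPairs Y U).card := by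
    intro f a b s ha hb h1
    have hd : Disjoint (s ∩ Q) (s ∩ crossPairs Y U) :=
      Finset.disjoint_of_subset_left Finset.inter_subset_right
        (Finset.disjoint_of_subset_right Finset.inter_subset_right hQR)
    rw [← Finset.prod_const, ← Finset.prod_const,
      Finset.prod_congr rfl fun e he => (ha e (Finset.mem_inter.1 he).2).symm,
      Finset.prod_congr (s₁ := s ∩ crossPairs Y U) rfl
        fun e he => (hb e (Finset.mem_inter.1 he).2).symm,
      ← Finset.prod_union hd]
    symm
    refine Finset.prod_subset (Finset.union_subset Finset.inter_subset_left
      Finset.inter_subset_left) fun e he hne => ?_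
    simp only [Finset.mem_union, Finset.mem_inter, he, true_and, not_or] at hne
    exact h1 e hne.1 hne.2
  have hnot : ∀ e ∈ crossPairs Y U, e ∉ Q := fun e he hq => Finset.disjoint_left.1 hQR hq he
  let x : Sym2 (Fin n) → ℝ := fun e => if e ∈ Q then p⁻¹ else if e ∈ crossPairs Y U then z else 1
  have hxQ : ∀ e ∈ Q, x e = p⁻¹ := fun e he => if_pos he
  have hxR : ∀ e ∈ crossPairs Y U, x e = z := fun e he => by simp [x, he, hnot e he]
  have hx1 : ∀ e, e ∉ Q → e ∉ crossPairs Y U → x e = 1 := fun e h1 h2 => by simp [x, h1, h2]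
  have hx0 : ∀ e, 0 ≤ x e := fun e => by
    simp only [x]
    split_ifs
    exacts [inv_nonneg.2 hp₀.le, hz₀, zero_le_one]
  have key := gnpProb_le_of_weight hp₀.le hp₁ A x hx0
    (C := p ^ Q.card * (z ^ D)⁻¹) (by positivity) (by
      intro G hG
      obtain ⟨hQG, hRG⟩ := hA G hG
      rw [hprod x p⁻¹ z (edges G) hxQ hxR hx1, Finset.inter_eq_right.2 hQG]
      have h1 : z ^ D ≤ z ^ (edges G ∩ crossPairs Y U).card := pow_le_pow_of_le_one hz₀ hz₁ hRG
      have h2 : p ^ Q.card * (z ^ D)⁻¹ * (p⁻¹ ^ Q.card *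
          z ^ (edges G ∩ crossPairs Y U).card) =
          (z ^ D)⁻¹ * z ^ (edges G ∩ crossPairs Y U).card := by
        rw [inv_pow]
        field_simp
      rw [h2, inv_mul_eq_div, one_le_div hzD]
      exact h1)
  refine key.trans ?_
  rw [hprod (fun e => 1 - p + p * x e) (2 - p) (1 - p + p * z) (vertexPairs n)
    (fun e he => by rw [hxQ e he, mul_inv_cancel₀ hp₀.ne']; ring)
    (fun e he => by rw [hxR e he]) (fun e h1 h2 => by rw [hx1 e h1 h2]; ring),
    Finset.inter_eq_right.2 hQ, Finset.inter_eq_right.2 (crossPairs_subset hYU),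
    card_crossPairs hYU]
  have h1 : (1 - p + p * z) ^ (Y.card * U.card) ≤
      Real.exp (-((1 - z) * p * (Y.card * U.card))) := by
    have h2 : 1 - p + p * z ≤ Real.exp (-((1 - z) * p)) := by
      have := Real.add_one_le_exp (-((1 - z) * p))
      linarith
    have h3 : 0 ≤ 1 - p + p * z := by
      have := mul_nonneg hp₀.le hz₀
      linarith
    refine (pow_le_pow_left₀ h3 h2 _).trans_eq ?_
    rw [← Real.exp_nat_mul]
    push_cast
    ring_nf
  have h4 : (2 - p) ^ Q.card ≤ 2 ^ Q.card := pow_le_pow_left₀ (by linarith) (by linarith) _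
  calc p ^ Q.card * (z ^ D)⁻¹ * ((2 - p) ^ Q.card * (1 - p + p * z) ^ (Y.card * U.card))
      ≤ p ^ Q.card * (z ^ D)⁻¹ * (2 ^ Q.card *
          Real.exp (-((1 - z) * p * (Y.card * U.card)))) := by
        gcongr
    _ = _ := by
        rw [mul_pow]
        ring

/-- Twice the number of edges inside `X` bounds the sum of the degrees inside `X`. -/
theorem sum_card_nbrs_inter_le (G : SimpleGraph (Fin n)) (X : Finset (Fin n)) :
    ∑ x ∈ X, (nbrs G x ∩ X).card ≤ 2 * (edges G ∩ X.sym2).card := by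
  let H : SimpleGraph (Fin n) :=
    { Adj := fun a b => G.Adj a b ∧ a ∈ X ∧ b ∈ X
      symm := ⟨fun _ _ h => ⟨h.1.symm, h.2.2, h.2.1⟩⟩
      loopless := ⟨fun a h => G.loopless.irrefl a h.1⟩ }
  have h := H.sum_degrees_eq_twice_card_edges
  have h1 : ∀ x ∈ X, (nbrs G x ∩ X).card ≤ H.degree x := by
    intro x hx
    rw [← SimpleGraph.card_neighborFinset_eq_degree]
    refine Finset.card_le_card fun y hy => ?_
    obtain ⟨h1, h2⟩ := Finset.mem_inter.1 hy
    rw [SimpleGraph.mem_neighborFinset]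
    exact ⟨mem_nbrs.1 h1, hx, h2⟩
  have h2 : H.edgeFinset ⊆ edges G ∩ X.sym2 := by
    intro e
    induction e with
    | _ a b =>
      intro he
      rw [SimpleGraph.mem_edgeFinset] at he
      exact Finset.mem_inter.2 ⟨mem_edges.2 he.1, Finset.mk_mem_sym2_iff.2 he.2⟩
  calc ∑ x ∈ X, (nbrs G x ∩ X).card ≤ ∑ x ∈ X, H.degree x := Finset.sum_le_sum h1
    _ ≤ ∑ x, H.degree x := Finset.sum_le_univ_sum_of_nonneg fun _ => Nat.zero_le _
    _ = 2 * H.edgeFinset.card := h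
    _ ≤ _ := Nat.mul_le_mul_left _ (Finset.card_le_card h2)

/-- The probability that `X` induces a subgraph of minimum degree at least `d`. -/
theorem gnpProb_dense_le (hp₀ : 0 ≤ p) (hp₁ : p ≤ 1) (X : Finset (Fin n)) (d : ℕ) {w : ℝ}
    (hw : 1 ≤ w) :
    gnpProb n p {G | ∀ x ∈ X, d ≤ (nbrs G x ∩ X).card} ≤
      (w ^ (X.card * d))⁻¹ * Real.exp (p * w ^ 2 * X.card ^ 2) := by
  have hw0 : 0 < w := by linarith
  let x : Sym2 (Fin n) → ℝ := fun e => if e ∈ X.sym2 then w ^ 2 else 1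
  have key := gnpProb_le_of_weight hp₀ hp₁ {G | ∀ x ∈ X, d ≤ (nbrs G x ∩ X).card} x
    (fun e => by simp only [x]; split_ifs <;> positivity)
    (C := (w ^ (X.card * d))⁻¹) (by positivity) (by
      intro G hG
      have h1 : X.card * d ≤ 2 * (edges G ∩ X.sym2).card :=
        (Finset.card_nsmul_le_sum _ _ d hG).trans (sum_card_nbrs_inter_le G X)
      have h2 : ∏ e ∈ edges G, x e = w ^ (2 * (edges G ∩ X.sym2).card) := by
        simp only [x]
        rw [← Finset.prod_filter, Finset.prod_const, Finset.filter_mem_eq_inter, pow_mul]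
      rw [h2, inv_mul_eq_div, one_le_div (by positivity)]
      exact pow_le_pow_right₀ hw h1)
  refine key.trans ?_
  gcongr
  have h3 : ∀ e ∈ vertexPairs n, 1 - p + p * x e ≤
      if e ∈ X.sym2 then Real.exp (p * w ^ 2) else 1 := by
    intro e _
    simp only [x]
    split_ifs
    · have := Real.add_one_le_exp (p * w ^ 2)
      linarith
    · linarith
  have h4 : ∀ e ∈ vertexPairs n, 0 ≤ 1 - p + p * x e := by
    intro e _
    have : 0 ≤ x e := by
      simp only [x]
      split_ifs <;> positivity
    have := mul_nonneg hp₀ this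
    linarith
  refine (Finset.prod_le_prod h4 h3).trans ?_
  rw [← Finset.prod_filter, Finset.prod_const, ← Real.exp_nat_mul, Finset.filter_mem_eq_inter]
  apply Real.exp_le_exp.2
  have h5 : (vertexPairs n ∩ X.sym2).card ≤ X.card ^ 2 := by
    refine (Finset.card_le_card Finset.inter_subset_right).trans ?_
    rw [Finset.card_sym2, Nat.choose_two_right, Nat.add_sub_cancel]
    apply Nat.div_le_of_le_mul
    nlinarith [Nat.zero_le X.card, Nat.le_mul_self X.card]
  have h6 : ((vertexPairs n ∩ X.sym2).card : ℝ) ≤ (X.card : ℝ) ^ 2 := by exact_mod_cast h5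
  have h7 : 0 ≤ p * w ^ 2 := by positivity
  nlinarith

end Probability

section Events

variable {n : ℕ} {p : ℝ}

theorem four_le_exp_two : 4 ≤ Real.exp 2 := by
  have h1 : (2 : ℝ) ≤ Real.exp 1 := by
    have := Real.add_one_le_exp (1 : ℝ)
    linarith
  have : Real.exp 2 = Real.exp 1 * Real.exp 1 := by
    rw [← Real.exp_add]
    norm_num
  nlinarith

theorem exp_neg_two_le : Real.exp (-2) ≤ 1 / 4 := by
  rw [Real.exp_neg, ← one_div]
  exact one_div_le_one_div_of_le (by norm_num) four_le_exp_two

/-- The probability that the pairs of `Q` are edges while all vertices of `Y` have fewer than `d`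
neighbours in `U`. -/
theorem gnpProb_small_le (hp₀ : 0 < p) (hp₁ : p ≤ 1) {Y U : Finset (Fin n)} (hYU : Disjoint Y U)
    {Q : Finset (Sym2 (Fin n))} (hQ : Q ⊆ vertexPairs n) (hQR : Disjoint Q (crossPairs Y U))
    {d : ℕ} (A : Set (SimpleGraph (Fin n)))
    (hA : ∀ G ∈ A, Q ⊆ edges G ∧ ∀ y ∈ Y, (nbrs G y ∩ U).card < d) :
    gnpProb n p A ≤
      (2 * p) ^ Q.card * Real.exp (Y.card * (2 * d - 3 / 4 * p * U.card)) := by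
  refine (gnpProb_cross_le hp₀ hp₁ hYU hQ hQR (Real.exp_pos (-2)).le
    (exp_neg_two_le.trans (by norm_num)) (D := Y.card * d) (by positivity) A fun G hG =>
      ⟨(hA G hG).1, card_edges_inter_crossPairs_le G Y U fun y hy =>
        ((hA G hG).2 y hy).le⟩).trans ?_
  gcongr
  rw [← Real.exp_nat_mul, ← Real.exp_neg, ← Real.exp_add]
  apply Real.exp_le_exp.2
  push_cast
  have h1 := exp_neg_two_le
  have h2 : 0 ≤ p * (Y.card * U.card) := by positivity
  nlinarith

theorem gnpProb_degree_le (hp₀ : 0 < p) (hp₁ : p ≤ 1) (k : ℕ) {z : ℝ} (hz₀ : 0 < z)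
    (hz₁ : z ≤ 1) :
    gnpProb n p {G | ∃ v, (nbrs G v).card ≤ k} ≤
      n * ((z ^ k)⁻¹ * Real.exp (-((1 - z) * p * (n - 1)))) := by
  have h1 : {G : SimpleGraph (Fin n) | ∃ v, (nbrs G v).card ≤ k} =
      {G | ∃ v ∈ (Finset.univ : Finset (Fin n)), G ∈ {G | (nbrs G v).card ≤ k}} := by
    simp
  rw [h1]
  refine (gnpProb_biUnion_le hp₀.le hp₁ _ _).trans ?_
  refine (Finset.sum_le_card_nsmul _ _ ((z ^ k)⁻¹ * Real.exp (-((1 - z) * p * (n - 1))))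
    fun v _ => ?_).trans (by simp)
  refine (gnpProb_cross_le hp₀ hp₁ (Y := {v}) (U := Finset.univ.erase v) (by simp) (Q := ∅)
    (by simp) (by simp) hz₀.le hz₁ (D := k) (by positivity) _ fun G hG => ⟨by simp, ?_⟩).trans ?_
  · refine (card_edges_inter_crossPairs_le G {v} _ (d := k) fun y hy => ?_).trans (by simp)
    rw [Finset.mem_singleton.1 hy]
    exact (Finset.card_le_card Finset.inter_subset_left).trans hG
  · have hn : 1 ≤ n := Nat.one_le_of_lt v.2
    simp [Finset.card_erase_of_mem, Nat.cast_sub hn]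

theorem card_nbrs_inter_lt {G : SimpleGraph (Fin n)} {v : Fin n} {d : ℕ}
    (h : (nbrs G v).card < d) (U : Finset (Fin n)) : (nbrs G v ∩ U).card < d :=
  (Finset.card_le_card Finset.inter_subset_left).trans_lt h

theorem gnpProb_adj_small_le (hp₀ : 0 < p) (hp₁ : p ≤ 1) (d : ℕ) :
    gnpProb n p {G | ∃ u v, (nbrs G u).card < d ∧ (nbrs G v).card < d ∧ G.Adj u v} ≤
      n ^ 2 * (2 * p * Real.exp (2 * (2 * d - 3 / 4 * p * (n - 2)))) := by
  refine (gnpProb_mono hp₀.le hp₁ (B := {G | ∃ q ∈ (Finset.univ : Finset (Fin n × Fin n)),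
    G ∈ {G : SimpleGraph (Fin n) | (nbrs G q.1).card < d ∧ (nbrs G q.2).card < d ∧
      G.Adj q.1 q.2}}) ?_).trans ?_
  · rintro G ⟨u, v, h⟩
    exact ⟨(u, v), Finset.mem_univ _, h⟩
  refine (gnpProb_biUnion_le hp₀.le hp₁ _ _).trans ?_
  refine (Finset.sum_le_card_nsmul _ _ (2 * p * Real.exp (2 * (2 * d - 3 / 4 * p * (n - 2))))
    fun q _ => ?_).trans_eq (by simp [sq])
  obtain ⟨u, v⟩ := q
  by_cases huv : u = v
  · have hempty : {G : SimpleGraph (Fin n) | (nbrs G u).card < d ∧ (nbrs G v).card < d ∧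
        G.Adj u v} = ∅ := by
      ext G
      simp [huv]
    simp only [hempty]
    have : gnpProb n p ∅ = 0 := by simp [gnpProb]
    rw [this]
    positivity
  have hY : ({u, v} : Finset (Fin n)).card = 2 := Finset.card_pair huv
  refine (gnpProb_small_le hp₀ hp₁ (Y := {u, v}) (U := Finset.univ \ {u, v})
    Finset.disjoint_sdiff (Q := {s(u, v)}) ?_ ?_ (d := d) _ fun G hG => ⟨?_, ?_⟩).trans ?_
  · simp [vertexPairs, huv]
  · rw [Finset.disjoint_singleton_left]
    intro h
    obtain ⟨⟨a, b⟩, hab, he⟩ := Finset.mem_image.1 h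
    simp only [Finset.mem_product, Finset.mem_sdiff, Finset.mem_insert, Finset.mem_singleton,
      Finset.mem_univ, true_and, not_or] at hab
    rcases Sym2.eq_iff.1 he with ⟨h1, h2⟩ | ⟨h1, h2⟩
    · exact hab.2.2 h2
    · exact hab.2.1 h2
  · simpa [mem_edges] using hG.2.2
  · intro y hy
    rcases Finset.mem_insert.1 hy with rfl | hy
    · exact card_nbrs_inter_lt hG.1 _
    · rw [Finset.mem_singleton.1 hy]
      exact card_nbrs_inter_lt hG.2.1 _
  · have hU : ((n : ℝ) - 2) ≤ ((Finset.univ \ {u, v} : Finset (Fin n)).card : ℝ) := by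
      have := Finset.le_card_sdiff ({u, v} : Finset (Fin n)) Finset.univ
      rw [Finset.card_univ, Fintype.card_fin, hY] at this
      have : n ≤ (Finset.univ \ {u, v} : Finset (Fin n)).card + 2 := by omega
      have : (n : ℝ) ≤ (Finset.univ \ {u, v} : Finset (Fin n)).card + 2 := by exact_mod_cast this
      linarith
    rw [hY, Finset.card_singleton, pow_one]
    push_cast
    gcongr

theorem gnpProb_common_small_le (hp₀ : 0 < p) (hp₁ : p ≤ 1) (d : ℕ) :
    gnpProb n p {G | ∃ u v w, u ≠ v ∧ (nbrs G u).card < d ∧ (nbrs G v).card < d ∧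
        G.Adj w u ∧ G.Adj w v} ≤
      n ^ 3 * ((2 * p) ^ 2 * Real.exp (2 * (2 * d - 3 / 4 * p * (n - 3)))) := by
  refine (gnpProb_mono hp₀.le hp₁ (B := {G | ∃ q ∈ (Finset.univ : Finset (Fin n × Fin n × Fin n)),
    G ∈ {G : SimpleGraph (Fin n) | q.1 ≠ q.2.1 ∧ (nbrs G q.1).card < d ∧
      (nbrs G q.2.1).card < d ∧ G.Adj q.2.2 q.1 ∧ G.Adj q.2.2 q.2.1}}) ?_).trans ?_
  · rintro G ⟨u, v, w, h⟩
    exact ⟨(u, v, w), Finset.mem_univ _, h⟩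
  refine (gnpProb_biUnion_le hp₀.le hp₁ _ _).trans ?_
  refine (Finset.sum_le_card_nsmul _ _
    ((2 * p) ^ 2 * Real.exp (2 * (2 * d - 3 / 4 * p * (n - 3))))
    fun q _ => ?_).trans_eq (by
      simp only [Finset.card_univ, Fintype.card_prod, Fintype.card_fin, nsmul_eq_mul]
      push_cast
      ring)
  obtain ⟨u, v, w⟩ := q
  by_cases huvw : u ≠ v ∧ w ≠ u ∧ w ≠ v
  swap
  · have hempty : {G : SimpleGraph (Fin n) | u ≠ v ∧ (nbrs G u).card < d ∧
        (nbrs G v).card < d ∧ G.Adj w u ∧ G.Adj w v} = ∅ := by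
      ext G
      simp only [Set.mem_ofPred_eq, Set.mem_empty_iff_false, iff_false]
      rintro ⟨h1, -, -, h2, h3⟩
      exact huvw ⟨h1, h2.ne, h3.ne⟩
    simp only [hempty]
    have : gnpProb n p ∅ = 0 := by simp [gnpProb]
    rw [this]
    positivity
  obtain ⟨huv, hwu, hwv⟩ := huvw
  have hY : ({u, v} : Finset (Fin n)).card = 2 := Finset.card_pair huv
  have hQ : ({s(w, u), s(w, v)} : Finset (Sym2 (Fin n))).card = 2 :=
    Finset.card_pair (by simpa [Sym2.eq_iff, huv] using fun h _ => hwv h)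
  refine (gnpProb_small_le hp₀ hp₁ (Y := {u, v}) (U := Finset.univ \ {u, v, w}) ?_
    (Q := {s(w, u), s(w, v)}) ?_ ?_ (d := d) _ fun G hG => ⟨?_, ?_⟩).trans ?_
  · rw [Finset.disjoint_left]
    intro a ha
    simp only [Finset.mem_insert, Finset.mem_singleton] at ha
    simp only [Finset.mem_sdiff, Finset.mem_insert, Finset.mem_singleton, Finset.mem_univ,
      true_and]
    tauto
  · intro e he
    rcases Finset.mem_insert.1 he with rfl | he
    · simp [vertexPairs, hwu]
    · rw [Finset.mem_singleton.1 he]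
      simp [vertexPairs, hwv]
  · rw [Finset.disjoint_left]
    intro e he h
    obtain ⟨⟨a, b⟩, hab, rfl⟩ := Finset.mem_image.1 h
    simp only [Finset.mem_product, Finset.mem_sdiff, Finset.mem_insert, Finset.mem_singleton,
      Finset.mem_univ, true_and, not_or] at hab
    simp only [Finset.mem_insert, Finset.mem_singleton, Sym2.eq_iff] at he
    tauto
  · intro e he
    rcases Finset.mem_insert.1 he with rfl | he
    · exact mem_edges.2 hG.2.2.2.1
    · rw [Finset.mem_singleton.1 he]
      exact mem_edges.2 hG.2.2.2.2
  · intro y hy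
    rcases Finset.mem_insert.1 hy with rfl | hy
    · exact card_nbrs_inter_lt hG.2.1 _
    · rw [Finset.mem_singleton.1 hy]
      exact card_nbrs_inter_lt hG.2.2.1 _
  · have hU : ((n : ℝ) - 3) ≤ ((Finset.univ \ {u, v, w} : Finset (Fin n)).card : ℝ) := by
      have h1 := Finset.le_card_sdiff ({u, v, w} : Finset (Fin n)) Finset.univ
      have h2 : ({u, v, w} : Finset (Fin n)).card ≤ 3 := Finset.card_le_three
      rw [Finset.card_univ, Fintype.card_fin] at h1
      have : n ≤ (Finset.univ \ {u, v, w} : Finset (Fin n)).card + 3 := by omega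
      have : (n : ℝ) ≤ (Finset.univ \ {u, v, w} : Finset (Fin n)).card + 3 := by exact_mod_cast this
      linarith
    rw [hY, hQ]
    push_cast
    gcongr

theorem le_card_residuePart {k j : ℕ} (hk : 1 ≤ k) (hj : j < k) :
    (n : ℝ) / k - 1 ≤ (residuePart n k j).card := by
  have h1 : n / k ≤ (residuePart n k j).card := by
    have hlt : ∀ i : Fin (n / k), i.1 * k + j < n := by
      intro i
      have h2 : (i.1 + 1) * k ≤ n / k * k := Nat.mul_le_mul_right _ i.2
      have h3 := Nat.div_mul_le_self n k
      nlinarith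
    have hcard := Finset.card_le_card_of_injOn (s := (Finset.univ : Finset (Fin (n / k))))
      (t := residuePart n k j) (fun i => (⟨i.1 * k + j, hlt i⟩ : Fin n))
      (by
        intro i _
        simp only [Finset.mem_coe, mem_residuePart]
        rw [mul_comm, Nat.mul_add_mod, Nat.mod_eq_of_lt hj])
      (by
        intro a _ b _ hab
        have h4 : a.1 * k + j = b.1 * k + j := congrArg Fin.val hab
        exact Fin.ext (Nat.eq_of_mul_eq_mul_right hk (by omega)))
    simpa using hcard
  have h2 : (n : ℝ) / k < (n / k : ℕ) + 1 := by
    rw [div_lt_iff₀ (by exact_mod_cast hk)]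
    have := Nat.lt_div_mul_add hk (a := n)
    have h3 : n < (n / k + 1) * k := by
      rw [add_mul, one_mul]
      exact this
    exact_mod_cast h3
  have h3 : ((n / k : ℕ) : ℝ) ≤ (residuePart n k j).card := by exact_mod_cast h1
  linarith

theorem gnpProb_many_poor_le (hp₀ : 0 < p) (hp₁ : p ≤ 1) {k : ℕ} (hk : 1 ≤ k) (d M : ℕ) :
    gnpProb n p {G | ∃ v, ∃ j < k, M ≤ (nbrs G v ∩ poorVerts G k d j).card} ≤
      n * k * n ^ M *
        ((2 * p) ^ M * Real.exp (M * (2 * d - 3 / 4 * p * (n / k - (M + 2))))) := by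
  set c : ℝ := (2 * p) ^ M * Real.exp (M * (2 * d - 3 / 4 * p * (n / k - (M + 2)))) with hc
  have hc0 : 0 ≤ c := by positivity
  let s : Finset (Fin n × ℕ × Finset (Fin n)) :=
    Finset.univ ×ˢ (Finset.range k ×ˢ Finset.powersetCard M Finset.univ)
  refine (gnpProb_mono hp₀.le hp₁ (B := {G | ∃ q ∈ s,
    G ∈ {G : SimpleGraph (Fin n) | q.2.2 ⊆ nbrs G q.1 ∧
      q.2.2 ⊆ poorVerts G k d q.2.1}}) ?_).trans ?_
  · rintro G ⟨v, j, hj, hM⟩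
    obtain ⟨Y, hY, hYM⟩ := Finset.exists_subset_card_eq hM
    refine ⟨(v, j, Y), ?_, hY.trans Finset.inter_subset_left, hY.trans Finset.inter_subset_right⟩
    simp [s, hj, Finset.mem_powersetCard, hYM]
  refine (gnpProb_biUnion_le hp₀.le hp₁ _ _).trans ?_
  have hs : (s.card : ℝ) ≤ n * k * n ^ M := by
    simp only [s, Finset.card_product, Finset.card_univ, Fintype.card_fin, Finset.card_range,
      Finset.card_powersetCard]
    have := Nat.choose_le_pow n M
    have h2 : n * (k * n.choose M) ≤ n * k * n ^ M := by
      rw [mul_assoc]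
      gcongr
    exact_mod_cast h2
  refine (Finset.sum_le_card_nsmul _ _ c fun q hq => ?_).trans (by
    rw [nsmul_eq_mul]
    exact mul_le_mul_of_nonneg_right hs hc0)
  obtain ⟨v, j, Y⟩ := q
  simp only [s, Finset.mem_product, Finset.mem_univ, Finset.mem_range, true_and,
    Finset.mem_powersetCard, Finset.subset_univ] at hq
  obtain ⟨hj, hYM⟩ := hq
  by_cases hvY : v ∈ Y
  · have hempty : {G : SimpleGraph (Fin n) | Y ⊆ nbrs G v ∧ Y ⊆ poorVerts G k d j} = ∅ := by
      ext G
      simp only [Set.mem_ofPred_eq, Set.mem_empty_iff_false, iff_false]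
      rintro ⟨h, -⟩
      exact (mem_nbrs.1 (h hvY)).ne rfl
    simp only [hempty]
    have : gnpProb n p ∅ = 0 := by simp [gnpProb]
    rw [this]
    exact hc0
  have hQ : (Y.image fun y => s(v, y)).card = M := by
    rw [Finset.card_image_of_injective, hYM]
    intro a b h
    rcases Sym2.eq_iff.1 h with ⟨-, h⟩ | ⟨h1, h2⟩
    · exact h
    · exact h2.trans h1
  refine (gnpProb_small_le hp₀ hp₁ (Y := Y) (U := residuePart n k j \ insert v Y) ?_
    (Q := Y.image fun y => s(v, y)) ?_ ?_ (d := d) _ fun G hG => ⟨?_, ?_⟩).trans ?_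
  · rw [Finset.disjoint_left]
    intro a ha
    simp [ha]
  · intro e he
    obtain ⟨y, hy, rfl⟩ := Finset.mem_image.1 he
    simp only [vertexPairs, Finset.mem_filter, Finset.mem_univ, true_and, Sym2.mk_isDiag_iff]
    rintro rfl
    exact hvY hy
  · rw [Finset.disjoint_left]
    intro e he h
    obtain ⟨⟨a, b⟩, hab, rfl⟩ := Finset.mem_image.1 h
    obtain ⟨y, hy, he⟩ := Finset.mem_image.1 he
    simp only [Finset.mem_product, Finset.mem_sdiff, Finset.mem_insert, not_or] at hab
    rcases Sym2.eq_iff.1 he with ⟨h1, h2⟩ | ⟨h1, h2⟩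
    · have h2' : y = b := h2
      exact hab.2.2.2 (h2' ▸ hy)
    · exact hab.2.2.1 h1.symm
  · intro e he
    obtain ⟨y, hy, rfl⟩ := Finset.mem_image.1 he
    exact mem_edges.2 (mem_nbrs.1 (hG.1 hy))
  · intro y hy
    have := hG.2 hy
    simp only [poorVerts, Finset.mem_filter, Finset.mem_univ, true_and] at this
    exact (Finset.card_le_card (Finset.inter_subset_inter_left Finset.sdiff_subset)).trans_lt this
  · have hU : (n : ℝ) / k - (M + 2) ≤ ((residuePart n k j \ insert v Y).card : ℝ) := by
      have h1 := Finset.le_card_sdiff (insert v Y) (residuePart n k j)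
      have h2 := Finset.card_insert_le v Y
      have h3 := le_card_residuePart (n := n) hk hj
      have h4 : (residuePart n k j).card ≤ (residuePart n k j \ insert v Y).card + (M + 1) := by
        omega
      have h5 : ((residuePart n k j).card : ℝ) ≤
          (residuePart n k j \ insert v Y).card + (M + 1) := by exact_mod_cast h4
      linarith
    rw [hQ, hYM, hc]
    gcongr

theorem gnpProb_not_sparse_le (hp₀ : 0 ≤ p) (hp₁ : p ≤ 1) (d m : ℕ) {w r : ℝ} (hw : 1 ≤ w)
    (hr : 0 ≤ r) (h : (w ^ d)⁻¹ * Real.exp (p * w ^ 2 * m) ≤ r) :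
    gnpProb n p {G | ¬ SmallSetsSparse G d m} ≤ Real.exp (n * r) - 1 := by
  have hw0 : 0 < w := by linarith
  let s : Finset (Finset (Fin n)) := (Finset.univ.erase ∅).filter fun X => X.card ≤ m
  refine (gnpProb_mono hp₀ hp₁ (B := {G | ∃ X ∈ s,
    G ∈ {G : SimpleGraph (Fin n) | ∀ x ∈ X, d ≤ (nbrs G x ∩ X).card}}) ?_).trans ?_
  · intro G hG
    simp only [Set.mem_ofPred_eq, SmallSetsSparse] at hG
    push Not at hG
    obtain ⟨X, hX, hXd, hXm⟩ := hG
    exact ⟨X, by simp [s, hX.ne_empty, hXm], hXd⟩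
  refine (gnpProb_biUnion_le hp₀ hp₁ _ _).trans ?_
  have h1 : ∀ X ∈ s, gnpProb n p {G : SimpleGraph (Fin n) | ∀ x ∈ X, d ≤ (nbrs G x ∩ X).card} ≤
      r ^ X.card := by
    intro X hX
    refine (gnpProb_dense_le hp₀ hp₁ X d hw).trans ?_
    have hXm : (X.card : ℝ) ≤ m := by
      exact_mod_cast (Finset.mem_filter.1 hX).2
    calc (w ^ (X.card * d))⁻¹ * Real.exp (p * w ^ 2 * X.card ^ 2)
        ≤ (w ^ (X.card * d))⁻¹ * Real.exp (p * w ^ 2 * (X.card * m)) := by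
          gcongr
          nlinarith [Nat.cast_nonneg (α := ℝ) X.card]
      _ = ((w ^ d)⁻¹ * Real.exp (p * w ^ 2 * m)) ^ X.card := by
          rw [mul_pow, inv_pow, ← pow_mul, mul_comm d, ← Real.exp_nat_mul]
          ring_nf
      _ ≤ r ^ X.card := by gcongr
  refine (Finset.sum_le_sum h1).trans ?_
  have h2 : ∑ X ∈ s, r ^ X.card ≤
      ∑ X ∈ (Finset.univ : Finset (Finset (Fin n))).erase ∅, r ^ X.card :=
    Finset.sum_le_sum_of_subset_of_nonneg (Finset.filter_subset _ _) fun _ _ _ => pow_nonneg hr _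
  have h3 : ∑ X : Finset (Fin n), r ^ X.card = (r + 1) ^ n := by
    simpa using Fin.sum_pow_mul_eq_add_pow (n := n) r 1
  have h4 := Finset.sum_erase_add (Finset.univ : Finset (Finset (Fin n)))
    (fun X => r ^ X.card) (Finset.mem_univ ∅)
  have h5 : (r + 1) ^ n ≤ Real.exp (n * r) := by
    rw [Real.exp_nat_mul]
    exact pow_le_pow_left₀ (by linarith) (Real.add_one_le_exp r) _
  simp only [Finset.card_empty, pow_zero] at h4
  linarith

theorem gnpProb_not_joined_le (hp₀ : 0 < p) (hp₁ : p ≤ 1) (m : ℕ) {c : ℝ} (hc : 0 ≤ c)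
    (hm : c ≤ m + 1) :
    gnpProb n p {G | ¬ LargeSetsJoined G m} ≤ 4 ^ n * Real.exp (-(p * c ^ 2)) := by
  let s : Finset (Finset (Fin n) × Finset (Fin n)) :=
    Finset.univ.filter fun q => Disjoint q.1 q.2 ∧ m < q.1.card ∧ m < q.2.card
  refine (gnpProb_mono hp₀.le hp₁ (B := {G | ∃ q ∈ s,
    G ∈ {G : SimpleGraph (Fin n) | ∀ x ∈ q.1, ∀ y ∈ q.2, ¬ G.Adj x y}}) ?_).trans ?_
  · intro G hG
    simp only [Set.mem_ofPred_eq, LargeSetsJoined] at hG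
    push Not at hG
    obtain ⟨X, Y, h1, h2, h3, h4⟩ := hG
    exact ⟨(X, Y), by simp [s, h1, h2, h3], h4⟩
  refine (gnpProb_biUnion_le hp₀.le hp₁ _ _).trans ?_
  have hs : (s.card : ℝ) ≤ 4 ^ n := by
    have h1 : s.card ≤ 2 ^ n * 2 ^ n := by
      refine (Finset.card_le_univ s).trans_eq ?_
      simp
    have h2 : 2 ^ n * 2 ^ n = 4 ^ n := by
      rw [← mul_pow]
      norm_num
    rw [h2] at h1
    exact_mod_cast h1
  refine (Finset.sum_le_card_nsmul _ _ (Real.exp (-(p * c ^ 2))) fun q hq => ?_).trans (by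
    rw [nsmul_eq_mul]
    exact mul_le_mul_of_nonneg_right hs (Real.exp_pos _).le)
  obtain ⟨hdis, hX, hY⟩ := (Finset.mem_filter.1 hq).2
  refine (gnpProb_cross_le hp₀ hp₁ hdis (Q := ∅) (by simp) (by simp) le_rfl zero_le_one (D := 0)
    (by simp) _ fun G hG => ⟨by simp, ?_⟩).trans ?_
  · refine (card_edges_inter_crossPairs_le G q.1 q.2 (d := 0) fun y hy => ?_).trans (by simp)
    rw [Nat.le_zero, Finset.card_eq_zero, Finset.eq_empty_iff_forall_notMem]
    intro z hz
    exact hG y hy z (Finset.mem_inter.1 hz).2 (mem_nbrs.1 (Finset.mem_inter.1 hz).1)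
  · simp only [Finset.card_empty, pow_zero, inv_one, one_mul, sub_zero]
    apply Real.exp_le_exp.2
    have h1 : c ≤ q.1.card := hm.trans (by exact_mod_cast hX)
    have h2 : c ≤ q.2.card := hm.trans (by exact_mod_cast hY)
    have h3 : c ^ 2 ≤ q.1.card * q.2.card := by
      rw [sq]
      exact mul_le_mul h1 h2 hc (hc.trans h1)
    have := mul_le_mul_of_nonneg_left h3 hp₀.le
    linarith

end Events

section Asymptotics

variable {k n d : ℕ} {p L : ℝ}

theorem degree_term_le (hL : 1 ≤ L) (hLL : 0 < Real.log L) (hn : Real.exp L = n) (hp₁ : p ≤ 1)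
    (hp₀ : 0 ≤ p) (hp : n * p = L + (k + 1) * Real.log L - Real.log (Real.log L))
    (hpL : n * p ≤ 2 * L) :
    n * (((1 / L) ^ k)⁻¹ * Real.exp (-((1 - 1 / L) * p * (n - 1)))) ≤
      Real.exp 3 * (Real.log L / L) := by
  have hL0 : 0 < L := by linarith
  have hn0 : (0 : ℝ) < n := hn ▸ Real.exp_pos L
  have h1 : 1 / L * (n * p) ≤ 2 := by
    rw [one_div, inv_mul_le_iff₀ hL0]
    linarith
  have h2 : 0 ≤ 1 / L * p := by positivity
  have h3 : Real.exp (-((1 - 1 / L) * p * (n - 1))) ≤ Real.exp 3 * Real.exp (-(n * p)) := by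
    rw [← Real.exp_add]
    apply Real.exp_le_exp.2
    nlinarith
  have h4 : Real.exp (-(n * p)) = (n : ℝ)⁻¹ * (L ^ (k + 1))⁻¹ * Real.log L := by
    have h5 : L ^ (k + 1) = Real.exp (((k : ℝ) + 1) * Real.log L) := by
      have := Real.exp_nat_mul (Real.log L) (k + 1)
      rw [Real.exp_log hL0] at this
      rw [← this]
      push_cast
      rfl
    have h6 : Real.exp (-(n * p)) = Real.exp (-L) * Real.exp (-(((k : ℝ) + 1) * Real.log L)) *
        Real.exp (Real.log (Real.log L)) := by
      rw [← Real.exp_add, ← Real.exp_add, hp]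
      ring_nf
    rw [h6, Real.exp_log hLL, h5, ← hn, Real.exp_neg, Real.exp_neg]
  calc n * (((1 / L) ^ k)⁻¹ * Real.exp (-((1 - 1 / L) * p * (n - 1))))
      ≤ n * (((1 / L) ^ k)⁻¹ * (Real.exp 3 * Real.exp (-(n * p)))) := by gcongr
    _ = Real.exp 3 * (Real.log L / L) := by
      rw [h4, one_div, inv_pow, inv_inv, pow_succ]
      field_simp

theorem adj_term_le (hn0 : 0 < n) (hp₁ : p ≤ 1) (hp₀ : 0 ≤ p) (hn : Real.exp L = n)
    (hLp : L ≤ n * p) (hpL : n * p ≤ 2 * L) (hd : 16 * (d : ℝ) ≤ L) :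
    n ^ 2 * (2 * p * Real.exp (2 * (2 * d - 3 / 4 * p * (n - 2)))) ≤
      4 * Real.exp 3 * (L ^ 1 * Real.exp (-(1 / 4) * L)) := by
  have h1 : Real.exp (2 * (2 * d - 3 / 4 * p * (n - 2))) ≤
      Real.exp 3 * Real.exp (-(1 / 4) * L) * Real.exp (-L) := by
    rw [← Real.exp_add, ← Real.exp_add]
    apply Real.exp_le_exp.2
    nlinarith
  have hL0 : 0 ≤ L := by linarith [Nat.cast_nonneg (α := ℝ) d]
  have h2 : (n : ℝ) * Real.exp (-L) = 1 := by
    rw [← hn, ← Real.exp_add]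
    simp
  calc n ^ 2 * (2 * p * Real.exp (2 * (2 * d - 3 / 4 * p * (n - 2))))
      ≤ n ^ 2 * (2 * p * (Real.exp 3 * Real.exp (-(1 / 4) * L) * Real.exp (-L))) := by gcongr
    _ = 2 * (n * p) * (Real.exp 3 * Real.exp (-(1 / 4) * L)) * (n * Real.exp (-L)) := by ring
    _ ≤ 2 * (2 * L) * (Real.exp 3 * Real.exp (-(1 / 4) * L)) * 1 := by
      rw [h2]
      gcongr
    _ = _ := by ring

theorem common_term_le (hn0 : 0 < n) (hp₁ : p ≤ 1) (hp₀ : 0 ≤ p) (hn : Real.exp L = n)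
    (hLp : L ≤ n * p) (hpL : n * p ≤ 2 * L) (hd : 16 * (d : ℝ) ≤ L) :
    n ^ 3 * ((2 * p) ^ 2 * Real.exp (2 * (2 * d - 3 / 4 * p * (n - 3)))) ≤
      16 * Real.exp 5 * (L ^ 2 * Real.exp (-(1 / 4) * L)) := by
  have h1 : Real.exp (2 * (2 * d - 3 / 4 * p * (n - 3))) ≤
      Real.exp 5 * Real.exp (-(1 / 4) * L) * Real.exp (-L) := by
    rw [← Real.exp_add, ← Real.exp_add]
    apply Real.exp_le_exp.2
    nlinarith
  have hL0 : 0 ≤ L := by linarith [Nat.cast_nonneg (α := ℝ) d]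
  have h2 : (n : ℝ) * Real.exp (-L) = 1 := by
    rw [← hn, ← Real.exp_add]
    simp
  calc n ^ 3 * ((2 * p) ^ 2 * Real.exp (2 * (2 * d - 3 / 4 * p * (n - 3))))
      ≤ n ^ 3 * ((2 * p) ^ 2 * (Real.exp 5 * Real.exp (-(1 / 4) * L) * Real.exp (-L))) := by
        gcongr
    _ = (2 * (n * p)) ^ 2 * (Real.exp 5 * Real.exp (-(1 / 4) * L)) * (n * Real.exp (-L)) := by
        ring
    _ ≤ (2 * (2 * L)) ^ 2 * (Real.exp 5 * Real.exp (-(1 / 4) * L)) * 1 := by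
      rw [h2]
      gcongr
    _ = _ := by ring

theorem poor_term_le (hk : 1 ≤ k) (hp₁ : p ≤ 1) (hp₀ : 0 ≤ p) (hn : Real.exp L = n)
    (hLp : L ≤ n * p) (hpL : n * p ≤ 2 * L) (hd : 16 * k * (d : ℝ) ≤ L) :
    n * k * n ^ (4 * k) * ((2 * p) ^ (4 * k) * Real.exp ((4 * k : ℕ) *
        (2 * d - 3 / 4 * p * (n / k - ((4 * k : ℕ) + 2))))) ≤
      k * 4 ^ (4 * k) * Real.exp (4 * k * (4 * k + 2)) *
        (L ^ (4 * k) * Real.exp (-1 * L)) := by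
  have hk0 : (1 : ℝ) ≤ k := by exact_mod_cast hk
  have hL0 : 0 ≤ L := le_trans (by positivity) hd
  have h1 : Real.exp ((4 * k : ℕ) * (2 * d - 3 / 4 * p * (n / k - ((4 * k : ℕ) + 2)))) ≤
      Real.exp (4 * k * (4 * k + 2)) * Real.exp (-1 * L) * Real.exp (-L) := by
    rw [← Real.exp_add, ← Real.exp_add]
    apply Real.exp_le_exp.2
    push_cast
    have h2 : 4 * (k : ℝ) * (2 * d - 3 / 4 * p * (n / k - (4 * k + 2))) =
        8 * k * d - 3 * (n * p) + 3 / 4 * (p * (4 * k * (4 * k + 2))) := by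
      field_simp
      ring
    have h3 : p * (4 * k * (4 * k + 2)) ≤ 1 * (4 * (k : ℝ) * (4 * k + 2)) := by gcongr
    have h4 : 0 ≤ 4 * (k : ℝ) * (4 * k + 2) := by positivity
    rw [h2]
    nlinarith
  have h2 : (n : ℝ) * Real.exp (-L) = 1 := by
    rw [← hn, ← Real.exp_add]
    simp
  calc n * k * n ^ (4 * k) * ((2 * p) ^ (4 * k) * Real.exp ((4 * k : ℕ) *
        (2 * d - 3 / 4 * p * (n / k - ((4 * k : ℕ) + 2)))))
      ≤ n * k * n ^ (4 * k) * ((2 * p) ^ (4 * k) *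
        (Real.exp (4 * k * (4 * k + 2)) * Real.exp (-1 * L) * Real.exp (-L))) := by gcongr
    _ = k * (2 * (n * p)) ^ (4 * k) * (Real.exp (4 * k * (4 * k + 2)) * Real.exp (-1 * L)) *
        (n * Real.exp (-L)) := by
        rw [mul_pow 2 p, mul_pow 2 (n * p), mul_pow (n : ℝ) p]
        ring
    _ ≤ k * (2 * (2 * L)) ^ (4 * k) *
        (Real.exp (4 * k * (4 * k + 2)) * Real.exp (-1 * L)) * 1 := by
        rw [h2]
        gcongr
    _ = _ := by
        rw [← mul_assoc 2 2 L, mul_pow]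
        norm_num
        ring

/-- The proportion of the vertices in a set that is large enough to be joined to every other
set of this size. -/
noncomputable def largeFraction (k : ℕ) : ℝ :=
  Real.exp (-(256 * k)) / 2

theorem largeFraction_pos (k : ℕ) : 0 < largeFraction k := by
  unfold largeFraction
  positivity

theorem sparse_term_le (hk : 1 ≤ k) (hp₀ : 0 ≤ p) (hpL : n * p ≤ 2 * L) (hL : 128 * k ≤ L)
    (hd : L / (32 * k) - 1 ≤ d) :
    (Real.exp (128 * k) ^ d)⁻¹ *
      Real.exp (p * Real.exp (128 * k) ^ 2 * (⌊largeFraction k * n⌋₊ : ℕ)) ≤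
        Real.exp (-(2 * L)) := by
  have hk0 : (1 : ℝ) ≤ k := by exact_mod_cast hk
  have h1 : ((⌊largeFraction k * n⌋₊ : ℕ) : ℝ) ≤ largeFraction k * n :=
    Nat.floor_le (mul_nonneg (largeFraction_pos k).le (Nat.cast_nonneg n))
  have h2 : Real.exp (128 * k) ^ 2 * largeFraction k = 1 / 2 := by
    rw [largeFraction, ← Real.exp_nat_mul, ← mul_div_assoc, ← Real.exp_add]
    push_cast
    ring_nf
    simp
  have h3 : p * Real.exp (128 * k) ^ 2 * (⌊largeFraction k * n⌋₊ : ℕ) ≤ L := by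
    calc p * Real.exp (128 * k) ^ 2 * (⌊largeFraction k * n⌋₊ : ℕ)
        ≤ p * Real.exp (128 * k) ^ 2 * (largeFraction k * n) := by gcongr
      _ = (Real.exp (128 * k) ^ 2 * largeFraction k) * (n * p) := by ring
      _ ≤ L := by
        rw [h2]
        linarith
  have h4 : 128 * k * (L / (32 * k) - 1) ≤ 128 * k * (d : ℝ) := by gcongr
  have h5 : 128 * k * (L / (32 * k) - 1) = 4 * L - 128 * k := by
    field_simp
    ring
  rw [← Real.exp_nat_mul, ← Real.exp_neg, ← Real.exp_add]
  apply Real.exp_le_exp.2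
  nlinarith

theorem joined_term_le (hn : Real.exp L = n) (hLp : L ≤ n * p)
    (hL : 3 ≤ largeFraction k ^ 2 * L) :
    4 ^ n * Real.exp (-(p * (largeFraction k * n) ^ 2)) ≤ Real.exp (-1 * L) := by
  have h4 := four_le_exp_two
  have hLn : L ≤ n := by
    have := Real.add_one_le_exp L
    linarith
  calc 4 ^ n * Real.exp (-(p * (largeFraction k * n) ^ 2))
      ≤ Real.exp 2 ^ n * Real.exp (-(p * (largeFraction k * n) ^ 2)) := by gcongr
    _ ≤ Real.exp (-1 * L) := by
      rw [← Real.exp_nat_mul, ← Real.exp_add]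
      apply Real.exp_le_exp.2
      have h1 : largeFraction k ^ 2 * n * L ≤ largeFraction k ^ 2 * n * (n * p) := by gcongr
      have h2 : (n : ℝ) * 3 ≤ n * (largeFraction k ^ 2 * L) := by gcongr
      nlinarith

/-- An upper bound for the probability that `G(n, p)` is not pseudorandom, in terms of
`L = log n`. -/
noncomputable def failureBound (k : ℕ) (L : ℝ) : ℝ :=
  Real.exp 3 * (Real.log L / L) +
  (4 * Real.exp 3 * (L ^ 1 * Real.exp (-(1 / 4) * L)) +
  (16 * Real.exp 5 * (L ^ 2 * Real.exp (-(1 / 4) * L)) +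
  (k * 4 ^ (4 * k) * Real.exp (4 * k * (4 * k + 2)) * (L ^ (4 * k) * Real.exp (-1 * L)) +
  ((Real.exp (Real.exp (-1 * L)) - 1) + Real.exp (-1 * L)))))

theorem tendsto_failureBound (k : ℕ) : Tendsto (failureBound k) atTop (nhds 0) := by
  have hpow : ∀ (a : ℕ) (b : ℝ), 0 < b →
      Tendsto (fun L : ℝ => L ^ a * Real.exp (-b * L)) atTop (nhds 0) := by
    intro a b hb
    simpa using tendsto_rpow_mul_exp_neg_mul_atTop_nhds_zero a b hb
  have h1 : Tendsto (fun L : ℝ => Real.log L / L) atTop (nhds 0) :=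
    Real.isLittleO_log_id_atTop.tendsto_div_nhds_zero
  have h2 : Tendsto (fun L : ℝ => Real.exp (-1 * L)) atTop (nhds 0) := by
    simpa using hpow 0 1 one_pos
  have h3 : Tendsto (fun L : ℝ => Real.exp (Real.exp (-1 * L)) - 1) atTop (nhds 0) := by
    simpa using ((Real.continuous_exp.tendsto 0).comp h2).sub_const 1
  have h4 := (h1.const_mul (Real.exp 3)).add
    (((hpow 1 (1 / 4) (by norm_num)).const_mul (4 * Real.exp 3)).add
    (((hpow 2 (1 / 4) (by norm_num)).const_mul (16 * Real.exp 5)).add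
    (((hpow (4 * k) 1 one_pos).const_mul
      (k * 4 ^ (4 * k) * Real.exp (4 * k * (4 * k + 2)))).add (h3.add h2))))
  simp only [mul_zero, add_zero] at h4
  exact h4

/-- `L` is large enough, depending on `k`, for the estimates on `G(n, p)` with `log n = L`. -/
structure IsLarge (k : ℕ) (L : ℝ) : Prop where
  one_le_log : 1 ≤ Real.log L
  mul_log_le : ((k : ℝ) + 1) * Real.log L ≤ L
  poly_le : 32 * (k : ℝ) * (4 * k ^ 2 + 9 * k + 5) ≤ L
  frac_le : 3 ≤ largeFraction k ^ 2 * L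

theorem eventually_isLarge (k : ℕ) : ∀ᶠ L : ℝ in atTop, IsLarge k L := by
  have h1 := Real.tendsto_log_atTop.eventually_ge_atTop 1
  have h2 := (Real.isLittleO_log_id_atTop.const_mul_left ((k : ℝ) + 1)).bound one_pos
  have h3 := eventually_ge_atTop (32 * (k : ℝ) * (4 * k ^ 2 + 9 * k + 5))
  have h4 := eventually_ge_atTop (3 / largeFraction k ^ 2)
  filter_upwards [h1, h2, h3, h4, eventually_ge_atTop 0] with L h1 h2 h3 h4 h5
  refine ⟨h1, ?_, h3, ?_⟩
  · rw [one_mul, Real.norm_eq_abs, Real.norm_eq_abs, id, abs_of_nonneg h5] at h2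
    exact (le_abs_self _).trans h2
  · rwa [div_le_iff₀' (pow_pos (largeFraction_pos k) 2)] at h4

theorem gnpProb_genKappa_ge (hk : 1 ≤ k) (hL : IsLarge k L) (hn : Real.exp L = n)
    (hp : n * p = L + (k + 1) * Real.log L - Real.log (Real.log L)) :
    0 ≤ p ∧ p ≤ 1 ∧
      1 - failureBound k L ≤ gnpProb n p {G : SimpleGraph (Fin n) | k ≤ genKappa 3 G} := by
  obtain ⟨hlog, hmul, hpoly, hfrac⟩ := hL
  have hk1 : (1 : ℝ) ≤ k := by exact_mod_cast hk
  have hL128 : 128 * (k : ℝ) ≤ L := by nlinarith [sq_nonneg (k : ℝ)]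
  have hL0 : 0 < L := by linarith
  have hLL : Real.log (Real.log L) ≤ Real.log L := by
    have := Real.log_le_sub_one_of_pos (zero_lt_one.trans_le hlog)
    linarith
  have hLL0 : 0 ≤ Real.log (Real.log L) := Real.log_nonneg hlog
  have hLp : L ≤ n * p := by nlinarith
  have hpL : n * p ≤ 2 * L := by linarith
  have hnL : 1 + L + L ^ 2 / 2 ≤ n := hn ▸ Real.quadratic_le_exp_of_nonneg hL0.le
  have hn0 : (0 : ℝ) < n := hn ▸ Real.exp_pos L
  have hn0' : 0 < n := by exact_mod_cast hn0
  have hn3 : 3 ≤ n := by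
    have : (3 : ℝ) ≤ n := by nlinarith
    exact_mod_cast this
  have hp0 : 0 < p := pos_of_mul_pos_right (hL0.trans_le hLp) hn0.le
  have hp1 : p ≤ 1 := by
    refine le_of_mul_le_mul_left ?_ hn0
    nlinarith
  refine ⟨hp0.le, hp1, ?_⟩
  set d : ℕ := ⌊L / (16 * k)⌋₊ with hd
  set d₀ : ℕ := ⌊L / (32 * k)⌋₊ with hd₀
  set m : ℕ := ⌊largeFraction k * n⌋₊ with hm
  have hdL : 16 * k * (d : ℝ) ≤ L := by
    have := Nat.floor_le (a := L / (16 * k)) (by positivity)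
    rwa [le_div_iff₀' (by positivity)] at this
  have hd16 : 16 * (d : ℝ) ≤ L := by nlinarith [Nat.cast_nonneg (α := ℝ) d]
  have hd₀L : L / (32 * k) - 1 ≤ d₀ := (Nat.sub_one_lt_floor _).le
  have hq : 4 * (k : ℝ) ^ 2 + 9 * k + 5 ≤ L / (32 * k) := by
    rw [le_div_iff₀' (by positivity)]
    exact hpoly
  have hd₀1 : 1 ≤ d₀ := by
    apply Nat.le_floor
    push_cast
    nlinarith
  have hdd : d₀ + k * (4 * k) + 9 * k + 4 ≤ d := by
    apply Nat.le_floor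
    push_cast
    have h1 := Nat.floor_le (a := L / (32 * k)) (by positivity)
    have h2 : L / (16 * k) = L / (32 * k) + L / (32 * k) := by
      field_simp
      norm_num
    rw [h2]
    nlinarith
  have hsub : (Set.univ : Set (SimpleGraph (Fin n))) ⊆ {G | k ≤ genKappa 3 G} ∪
      ({G | ∃ v, (nbrs G v).card ≤ k} ∪
      ({G | ∃ u v, (nbrs G u).card < d ∧ (nbrs G v).card < d ∧ G.Adj u v} ∪
      ({G | ∃ u v w, u ≠ v ∧ (nbrs G u).card < d ∧ (nbrs G v).card < d ∧
        G.Adj w u ∧ G.Adj w v} ∪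
      ({G | ∃ v, ∃ j < k, 4 * k ≤ (nbrs G v ∩ poorVerts G k d j).card} ∪
      ({G | ¬ SmallSetsSparse G d₀ m} ∪ {G | ¬ LargeSetsJoined G m}))))) := by
    intro G _
    by_contra hG
    simp only [Set.mem_union, Set.mem_ofPred_eq, not_or, not_not] at hG
    obtain ⟨h0, h1, h2, h3, h4, h5, h6⟩ := hG
    push Not at h1 h2 h3 h4
    have hG : IsPseudorandom G k d₀ d (4 * k) m :=
      { le_degree := h1
        not_adj := h2
        not_common := h3
        few_poor := h4
        sparse := h5
        joined := h6 }
    exact h0 (hG.le_genKappa hn3 hk hd₀1 hdd)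
  have hle := gnpProb_mono hp0.le hp1 hsub
  have hU := fun A B : Set (SimpleGraph (Fin n)) => gnpProb_union_le hp0.le hp1 A B
  have b1 := (gnpProb_degree_le (n := n) hp0 hp1 k (z := 1 / L) (by positivity)
    ((div_le_one hL0).2 (by linarith))).trans
      (degree_term_le (by linarith) (by linarith) hn hp1 hp0.le hp hpL)
  have b2 := (gnpProb_adj_small_le (n := n) hp0 hp1 d).trans
    (adj_term_le hn0' hp1 hp0.le hn hLp hpL hd16)
  have b3 := (gnpProb_common_small_le (n := n) hp0 hp1 d).trans
    (common_term_le hn0' hp1 hp0.le hn hLp hpL hd16)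
  have b4 := (gnpProb_many_poor_le (n := n) hp0 hp1 hk d (4 * k)).trans
    (poor_term_le hk hp1 hp0.le hn hLp hpL hdL)
  have b5 := gnpProb_not_sparse_le (n := n) hp0.le hp1 d₀ m
    (w := Real.exp (128 * k)) (Real.one_le_exp (by positivity)) (Real.exp_pos (-(2 * L))).le
    (sparse_term_le hk hp0.le hpL hL128 hd₀L)
  have h5 : (n : ℝ) * Real.exp (-(2 * L)) = Real.exp (-1 * L) := by
    rw [← hn, ← Real.exp_add]
    ring_nf
  rw [h5] at b5
  have b6 := (gnpProb_not_joined_le (n := n) hp0 hp1 m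
    (mul_nonneg (largeFraction_pos k).le hn0.le) (Nat.lt_floor_add_one _).le).trans
      (joined_term_le hn hLp hfrac)
  rw [gnpProb_univ] at hle
  have hchain := hle.trans ((hU _ _).trans (add_le_add_right ((hU _ _).trans
    (add_le_add b1 ((hU _ _).trans (add_le_add b2 ((hU _ _).trans (add_le_add b3
      ((hU _ _).trans (add_le_add b4 ((hU _ _).trans (add_le_add b5 b6)))))))))) _))
  unfold failureBound
  linarith

end Asymptotics

/-- Almost surely `κ₃(G(n, p(n))) ≥ k` for
`p(n) = (log n + (k+1) log log n − log log log n)/n`. -/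
theorem genKappa_three_ge_as (k : ℕ) (hk : 1 ≤ k) :
    Tendsto (fun n : ℕ =>
      gnpProb n ((Real.log n + ((k : ℝ) + 1) * Real.log (Real.log n) -
          Real.log (Real.log (Real.log n))) / n)
        {G : SimpleGraph (Fin n) | k ≤ genKappa 3 G})
      atTop (nhds 1) := by
  have hlog : Tendsto (fun n : ℕ => Real.log n) atTop atTop :=
    Real.tendsto_log_atTop.comp tendsto_natCast_atTop_atTop
  have hbound : ∀ᶠ n : ℕ in atTop, _ := (hlog.eventually (eventually_isLarge k)).and
    (eventually_ge_atTop 1) |>.mono fun n h => gnpProb_genKappa_ge (n := n) hk h.1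
      (Real.exp_log (by exact_mod_cast h.2))
      (mul_div_cancel₀ _ (by exact_mod_cast (Nat.one_le_iff_ne_zero.1 h.2)))
  have hlim : Tendsto (fun n : ℕ => 1 - failureBound k (Real.log n)) atTop (nhds 1) := by
    simpa using ((tendsto_failureBound k).comp hlog).const_sub 1
  refine tendsto_of_tendsto_of_tendsto_of_le_of_le' hlim tendsto_const_nhds
    (hbound.mono fun n h => h.2.2) (hbound.mono fun n h => ?_)
  exact (gnpProb_mono h.1 h.2.1 (Set.subset_univ _)).trans_eq (gnpProb_univ _ _)
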